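/- arXiv:2002.04926 — 11 statements merged into one kernel-verified Lean document; each statement's English description precedes it below -/
import Mathlib

section
/- Let K ≥ 2, γ > 0, and ŷ ∈ [0,1]^K. Let p = p(ŷ, γ) be the SquareCB action distribution. Then for every vector f* ∈ [0,1]^K and every a* ∈ argmin_{a∈[K]} f*_a, one has Σ_{a=1}^{K} p_a · [ (f*_a − f*_{a*}) − (γ/4)(ŷ_a − f*_a)² ] ≤ 2K/γ. -/
open Finset

/-- The SquareCB action distribution `p(ŷ, γ)` (with exploration parameter `μ = K`):
given a minimizing index `b` of `ŷ`, set `p_a = 1/(K + γ(ŷ_a − ŷ_b))` for `a ≠ b`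
and `p_b = 1 − Σ_{a≠b} p_a`. -/
noncomputable def squareCBProb (K : ℕ) (γ : ℝ) (yhat : Fin K → ℝ) (b : Fin K) :
    Fin K → ℝ := fun a =>
  if a = b then 1 - ∑ a' ∈ Finset.univ.erase b, ((K : ℝ) + γ * (yhat a' - yhat b))⁻¹
  else ((K : ℝ) + γ * (yhat a - yhat b))⁻¹

theorem scb_star (k g p u t : ℝ) (hg : 0 < g) (hp : 0 < p)
    (h : 1 ≤ p * (k + g * u)) :
    (1 - p) * t - g / 4 * (p * t ^ 2) ≤ (k + g * u - 2 + p) / g := by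
  rw [le_div_iff₀ hg]
  have h2 : 0 ≤ (1 - p - g * p * t / 2) ^ 2 := sq_nonneg _
  have h3 : ((1 - p) * t - g / 4 * (p * t ^ 2)) * g * p ≤ (k + g * u - 2 + p) * p := by
    nlinarith
  exact le_of_mul_le_mul_right h3 hp

theorem scb_abs (K : ℕ) (γ : ℝ) (hγ : 0 < γ) (y f p : Fin K → ℝ) (b s : Fin K)
    (hp : ∀ a, 0 < p a) (hsum : ∑ a, p a = 1)
    (h1 : ∀ a, 1 ≤ p a * (K + γ * (y a - y b)))
    (h2 : ∀ a, p a * (y a - y b) ≤ 1 / γ) :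
    ∑ a, p a * ((f a - f s) - (γ / 4) * (y a - f a) ^ 2) ≤ 2 * K / γ := by
  have hs := scb_star K γ (p s) (y s - y b) (y s - f s) hγ (hp s) (h1 s)
  have key : ∀ a, p a * ((f a - f s) - (γ / 4) * (y a - f a) ^ 2) ≤
      p a * (1 / γ + (y b - f s)) + 1 / γ +
      (if a = s then - (γ / 4) * (p s * (y s - f s) ^ 2) - p s / γ - p s * (y s - f s)
        else 0) := by
    intro a
    by_cases h : a = s
    · subst h
      simp only [if_true]
      have := h2 a
      have e : p a * (1 / γ) = p a / γ := by ring
      linarith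
    · simp only [h, if_false, add_zero]
      have h3 : (f a - y a) - γ / 4 * (y a - f a) ^ 2 ≤ 1 / γ := by
        rw [le_div_iff₀ hγ]
        nlinarith [sq_nonneg (γ * (f a - y a) / 2 - 1)]
      have h4 := mul_le_mul_of_nonneg_left h3 (hp a).le
      have := h2 a
      linarith
  refine (Finset.sum_le_sum fun a _ => key a).trans ?_
  rw [Finset.sum_add_distrib, Finset.sum_add_distrib, ← Finset.sum_mul, hsum]
  simp only [Finset.sum_ite_eq', Finset.mem_univ, if_true, Finset.sum_const, Finset.card_univ,
    Fintype.card_fin, nsmul_eq_mul]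
  have e : (K + γ * (y s - y b) - 2 + p s) / γ =
      K / γ + (y s - y b) - 2 / γ + p s / γ := by field_simp
  rw [e] at hs
  have e2 : 2 * (K:ℝ) / γ = K / γ + K / γ := by ring
  have e3 : (K:ℝ) * (1 / γ) = K / γ := by ring
  have e4 : 2 / γ = 1 / γ + 1 / γ := by ring
  have : 0 < 1 / γ := by positivity
  rw [e2, e3]
  linarith

/-- per-round inequality, Lemma `per_step`: for `K ≥ 2`, `γ > 0`,
`ŷ ∈ [0,1]^K`, the SquareCB action distribution `p = p(ŷ, γ)` satisfies, for every
`f* ∈ [0,1]^K` and every `a* ∈ argmin_a f*_a`,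
`Σ_a p_a [(f*_a − f*_{a*}) − (γ/4)(ŷ_a − f*_a)²] ≤ 2K/γ`. -/
theorem squareCB_per_step_bound (K : ℕ) (hK : 2 ≤ K) (γ : ℝ) (hγ : 0 < γ)
    (yhat : Fin K → ℝ) (hyhat : ∀ a, yhat a ∈ Set.Icc (0 : ℝ) 1)
    (b : Fin K) (hb : ∀ a, yhat b ≤ yhat a)
    (fstar : Fin K → ℝ) (hfstar : ∀ a, fstar a ∈ Set.Icc (0 : ℝ) 1)
    (astar : Fin K) (hastar : ∀ a, fstar astar ≤ fstar a) :
    ∑ a : Fin K, squareCBProb K γ yhat b a *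
        ((fstar a - fstar astar) - (γ / 4) * (yhat a - fstar a) ^ 2)
      ≤ 2 * K / γ := by
  have hK0 : (0:ℝ) < K := by
    have : 0 < K := by omega
    exact_mod_cast this
  have hu : ∀ a, 0 ≤ γ * (yhat a - yhat b) := fun a =>
    mul_nonneg hγ.le (sub_nonneg.2 (hb a))
  have hpb : (K:ℝ)⁻¹ ≤ squareCBProb K γ yhat b b := by
    simp only [squareCBProb, if_true]
    have h : ∑ a' ∈ Finset.univ.erase b, ((K : ℝ) + γ * (yhat a' - yhat b))⁻¹ ≤
        ∑ a' ∈ Finset.univ.erase b, (K : ℝ)⁻¹ := by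
      refine Finset.sum_le_sum fun a _ => ?_
      exact inv_anti₀ hK0 (by linarith [hu a])
    have h' : ∑ a' ∈ Finset.univ.erase b, (K : ℝ)⁻¹ + (K : ℝ)⁻¹ = 1 := by
      rw [Finset.sum_erase_add _ _ (Finset.mem_univ b)]
      simp [hK0.ne']
    linarith
  have hpa : ∀ a, a ≠ b →
      squareCBProb K γ yhat b a = ((K : ℝ) + γ * (yhat a - yhat b))⁻¹ := by
    intro a h
    simp [squareCBProb, h]
  refine scb_abs K γ hγ yhat fstar _ b astar ?_ ?_ ?_ ?_
  · intro a
    by_cases h : a = b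
    · subst h; exact lt_of_lt_of_le (by positivity) hpb
    · rw [hpa a h]
      have := hu a
      positivity
  · rw [← Finset.sum_erase_add _ _ (Finset.mem_univ b),
      Finset.sum_congr rfl fun a ha => hpa a (Finset.ne_of_mem_erase ha)]
    simp [squareCBProb]
  · intro a
    by_cases h : a = b
    · subst h
      rw [sub_self, mul_zero, add_zero]
      calc (1:ℝ) = (K:ℝ)⁻¹ * K := (inv_mul_cancel₀ hK0.ne').symm
        _ ≤ _ := mul_le_mul_of_nonneg_right hpb hK0.le
    · rw [hpa a h, inv_mul_cancel₀ (by linarith [hu a])]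
  · intro a
    by_cases h : a = b
    · subst h
      rw [sub_self, mul_zero]
      positivity
    · rw [hpa a h, le_div_iff₀ hγ, mul_assoc, inv_mul_le_iff₀ (by linarith [hu a])]
      linarith
end

section
/- Let K ≥ 2, γ > 0, T ≥ 1. For each t ∈ [T] let ŷ_t ∈ [0,1]^K and g_t ∈ [0,1]^K be arbitrary vectors, and let p_t = p(ŷ_t, γ) be the SquareCB action distribution built from ŷ_t. Then Σ_{t=1}^{T} ( Σ_a p_{t,a} g_{t,a} − min_{a∈[K]} g_{t,a} ) ≤ 2KT/γ + (γ/4) Σ_{t=1}^{T} Σ_a p_{t,a} (ŷ_{t,a} − g_{t,a})². -/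
open Finset

lemma round_aux (K : ℕ) (hK : 2 ≤ K) (γ : ℝ) (hγ : 0 < γ) (y g p : Fin K → ℝ) (b s : Fin K)
    (hb : ∀ a, y b ≤ y a) (hp : ∀ a, 0 ≤ p a) (hsum : ∑ a, p a = 1)
    (hpu : ∀ a, p a * (y a - y b) ≤ 1 / γ)
    (hps : 1 ≤ p s * (K + γ * (y s - y b))) :
    (∑ a, p a * g a) - g s ≤ 2 * K / γ + (γ / 4) * ∑ a, p a * (y a - g a) ^ 2 := by
  have hK' : (2 : ℝ) ≤ K := by exact_mod_cast hK
  have hid : ∀ a, p a * g a - (γ / 4) * (p a * (y a - g a) ^ 2)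
      = p a * (y a - y b) + p a * y b + p a * (1 / γ)
        - γ / 4 * (p a * (g a - y a - 2 / γ) ^ 2) := by
    intro a
    field_simp
    ring
  have h1 : (∑ a, p a * g a) - (γ / 4) * ∑ a, p a * (y a - g a) ^ 2
      = (∑ a, p a * (y a - y b)) + y b + 1 / γ
        - γ / 4 * ∑ a, p a * (g a - y a - 2 / γ) ^ 2 := by
    rw [Finset.mul_sum, ← Finset.sum_sub_distrib, Finset.sum_congr rfl (fun a _ => hid a),
      Finset.sum_sub_distrib, Finset.sum_add_distrib, Finset.sum_add_distrib,
      ← Finset.sum_mul, ← Finset.sum_mul, hsum, Finset.mul_sum]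
    ring
  have h2 : ∑ a, p a * (y a - y b) ≤ K * (1 / γ) := by
    have := Finset.sum_le_sum (s := Finset.univ) (fun a _ => hpu a)
    simpa using this
  have h3 : p s * (g s - y s - 2 / γ) ^ 2 ≤ ∑ a, p a * (g a - y a - 2 / γ) ^ 2 :=
    Finset.single_le_sum (f := fun a => p a * (g a - y a - 2 / γ) ^ 2)
      (fun a _ => mul_nonneg (hp a) (sq_nonneg _)) (Finset.mem_univ s)
  have h4 : γ / 4 * (p s * (g s - y s - 2 / γ) ^ 2)
      ≤ γ / 4 * ∑ a, p a * (g a - y a - 2 / γ) ^ 2 :=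
    mul_le_mul_of_nonneg_left h3 (by positivity)
  obtain ⟨e, he⟩ : ∃ e, e = g s - y s - 2 / γ := ⟨_, rfl⟩
  obtain ⟨w, hw⟩ : ∃ w, w = (K : ℝ) + γ * (y s - y b) := ⟨_, rfl⟩
  rw [← he] at h4
  rw [← hw] at hps
  have hw0 : 0 < w := by
    have := mul_nonneg hγ.le (sub_nonneg.2 (hb s))
    linarith
  have h5 : 0 ≤ γ / 4 * (p s * e ^ 2) + e + w / γ := by
    have hp1 : 1 / w ≤ p s := by rwa [div_le_iff₀ hw0]
    have h6 : γ / 4 * (1 / w * e ^ 2) ≤ γ / 4 * (p s * e ^ 2) := by gcongr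
    have h7 : γ / 4 * (1 / w * e ^ 2) + e + w / γ = (γ * e / 2 + w) ^ 2 / (γ * w) := by
      field_simp
      ring
    have h8 : 0 ≤ (γ * e / 2 + w) ^ 2 / (γ * w) := by positivity
    linarith
  have h9 : w / γ = K * (1 / γ) + (y s - y b) := by
    rw [hw]; field_simp
  have h10 : 2 * K / γ = 2 * (K * (1 / γ)) := by ring
  have h11 : 2 / γ = 2 * (1 / γ) := by ring
  have h12 : 0 < 1 / γ := by positivity
  rw [h10]
  linarith

/-- for `K ≥ 2`, `γ > 0`, `T ≥ 1`, arbitrary vectors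
`ŷ_t, g_t ∈ [0,1]^K` and `p_t = p(ŷ_t, γ)` the SquareCB action distribution built
from `ŷ_t`, one has
`Σ_t (Σ_a p_{t,a} g_{t,a} − min_a g_{t,a}) ≤ 2KT/γ + (γ/4) Σ_t Σ_a p_{t,a} (ŷ_{t,a} − g_{t,a})²`. -/
theorem squareCB_cumulative_bound (K : ℕ) (hK : 2 ≤ K) (γ : ℝ) (hγ : 0 < γ)
    (T : ℕ) (hT : 1 ≤ T)
    (yhat g : Fin T → Fin K → ℝ)
    (hyhat : ∀ t a, yhat t a ∈ Set.Icc (0 : ℝ) 1)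
    (hg : ∀ t a, g t a ∈ Set.Icc (0 : ℝ) 1)
    (b : Fin T → Fin K) (hb : ∀ t a, yhat t (b t) ≤ yhat t a) :
    ∑ t : Fin T, ((∑ a : Fin K, squareCBProb K γ (yhat t) (b t) a * g t a) - ⨅ a : Fin K, g t a)
      ≤ 2 * K * T / γ +
        (γ / 4) * ∑ t : Fin T, ∑ a : Fin K,
          squareCBProb K γ (yhat t) (b t) a * (yhat t a - g t a) ^ 2 := by
  have hK0 : (0 : ℝ) < K := by positivity
  have : Nonempty (Fin K) := ⟨⟨0, by omega⟩⟩
  have key : ∀ t : Fin T, (∑ a : Fin K, squareCBProb K γ (yhat t) (b t) a * g t a)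
      - (⨅ a : Fin K, g t a) ≤ 2 * K / γ + (γ / 4) * ∑ a : Fin K,
          squareCBProb K γ (yhat t) (b t) a * (yhat t a - g t a) ^ 2 := by
    intro t
    obtain ⟨s, hs⟩ := exists_eq_ciInf_of_finite (f := g t)
    rw [← hs]
    have hw : ∀ a, (K : ℝ) ≤ K + γ * (yhat t a - yhat t (b t)) := fun a => by
      have := mul_nonneg hγ.le (sub_nonneg.2 (hb t a))
      linarith
    have hle : ∀ a, ((K : ℝ) + γ * (yhat t a - yhat t (b t)))⁻¹ ≤ (K : ℝ)⁻¹ := fun a =>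
      inv_anti₀ hK0 (hw a)
    have hpb : (K : ℝ)⁻¹ ≤ squareCBProb K γ (yhat t) (b t) (b t) := by
      have h := Finset.sum_le_sum (s := Finset.univ.erase (b t)) (fun a _ => hle a)
      rw [Finset.sum_const, Finset.card_erase_of_mem (Finset.mem_univ _), Finset.card_univ,
        Fintype.card_fin, nsmul_eq_mul, Nat.cast_sub (by omega), Nat.cast_one, sub_mul,
        mul_inv_cancel₀ hK0.ne'] at h
      simp only [squareCBProb, if_true]
      linarith
    apply round_aux K hK γ hγ (yhat t) (g t) _ (b t) s (hb t)
    · intro a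
      by_cases h : a = b t
      · rw [h]; exact le_trans (by positivity) hpb
      · simp only [squareCBProb, if_neg h]
        exact inv_nonneg.2 (hK0.le.trans (hw a))
    · rw [← Finset.add_sum_erase _ _ (Finset.mem_univ (b t))]
      have : ∑ a ∈ Finset.univ.erase (b t), squareCBProb K γ (yhat t) (b t) a
          = ∑ a ∈ Finset.univ.erase (b t), ((K : ℝ) + γ * (yhat t a - yhat t (b t)))⁻¹ :=
        Finset.sum_congr rfl fun a ha => by
          simp only [squareCBProb, if_neg (Finset.ne_of_mem_erase ha)]
      rw [this]
      simp only [squareCBProb, if_true]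
      ring
    · intro a
      by_cases h : a = b t
      · rw [h, sub_self, mul_zero]; positivity
      · simp only [squareCBProb, if_neg h]
        have h0 := hK0.trans_le (hw a)
        rw [inv_mul_eq_div, div_le_div_iff₀ h0 hγ]
        linarith
    · by_cases h : s = b t
      · rw [h, sub_self, mul_zero, add_zero]
        have := mul_le_mul_of_nonneg_right hpb hK0.le
        rwa [inv_mul_cancel₀ hK0.ne'] at this
      · simp only [squareCBProb, if_neg h]
        rw [inv_mul_cancel₀ (hK0.trans_le (hw s)).ne']
  refine (Finset.sum_le_sum fun t _ => key t).trans (le_of_eq ?_)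
  rw [Finset.sum_add_distrib, ← Finset.mul_sum]
  simp only [Finset.sum_const, Finset.card_univ, Fintype.card_fin, nsmul_eq_mul]
  ring
end

section
/- For every K ≥ 2 and every γ > 0, the per-round minimax value satisfies Val(γ) ≤ 2K/γ. In fact, for every ŷ ∈ [0,1]^K the SquareCB action distribution p = p(ŷ, γ) certifies this: sup_{f*∈[0,1]^K} max_{a*∈[K]} Σ_a p_a [ f*_a − f*_{a*} − (γ/4)(ŷ_a − f*_a)² ] ≤ 2K/γ. -/
open Finset

/-- The per-round minimax value
`Val(γ) = sup_{ŷ∈[0,1]^K} inf_{p∈Δ_K} sup_{f*∈[0,1]^K} max_{a*∈[K]}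
   E_{a∼p}[f*_a − f*_{a*} − (γ/4)(ŷ_a − f*_a)²]`. -/
noncomputable def squareCBVal (K : ℕ) (γ : ℝ) : ℝ :=
  ⨆ yhat : {y : Fin K → ℝ // ∀ a, y a ∈ Set.Icc (0 : ℝ) 1},
    ⨅ p : {p : Fin K → ℝ // (∀ a, 0 ≤ p a) ∧ ∑ a, p a = 1},
      ⨆ fstar : {f : Fin K → ℝ // ∀ a, f a ∈ Set.Icc (0 : ℝ) 1},
        ⨆ astar : Fin K,
          ∑ a : Fin K, p.1 a *
            (fstar.1 a - fstar.1 astar - (γ / 4) * (yhat.1 a - fstar.1 a) ^ 2)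

theorem scb_sum_bound (K : ℕ) (γ : ℝ) (hγ : 0 < γ) (y : Fin K → ℝ) (b : Fin K)
    (p : Fin K → ℝ) (hp0 : ∀ a, 0 < p a) (hp1 : ∑ a, p a = 1)
    (hpb : ∀ a, (p a)⁻¹ ≤ K + γ * (y a - y b))
    (hd : ∀ a, p a * (γ * (y a - y b)) ≤ 1)
    (f : Fin K → ℝ) (s : Fin K) :
    ∑ a : Fin K, p a * (f a - f s - (γ / 4) * (y a - f a) ^ 2) ≤ 2 * K / γ := by
  have h1 : ∑ a, p a * (f a - f s - (γ / 4) * (y a - f a) ^ 2)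
      = ∑ a, p a * ((f a - y a) - (γ / 4) * (y a - f a) ^ 2)
        + ∑ a, p a * (y a - y b) + (y b - f s) := by
    have : (y b - f s) = ∑ a, p a * (y b - f s) := by
      rw [← Finset.sum_mul, hp1, one_mul]
    rw [this, ← Finset.sum_add_distrib, ← Finset.sum_add_distrib]
    exact Finset.sum_congr rfl fun a _ => by ring
  have h2 : ∑ a, p a * (y a - y b) ≤ K / γ := by
    have : ∑ a, p a * (y a - y b) ≤ ∑ _a : Fin K, 1 / γ := by
      refine Finset.sum_le_sum fun a _ => ?_
      rw [le_div_iff₀ hγ]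
      linarith [hd a]
    simpa [div_eq_mul_inv] using this
  have key : ∀ u : ℝ, u - γ / 4 * u ^ 2 ≤ 1 / γ := by
    intro u
    rw [le_div_iff₀ hγ]
    nlinarith [sq_nonneg (γ * u - 2)]
  have h3 : ∑ a, p a * ((f a - y a) - (γ / 4) * (y a - f a) ^ 2)
      ≤ p s * ((f s - y s) - (γ / 4) * (y s - f s) ^ 2) + (1 - p s) * (1 / γ) := by
    rw [← Finset.add_sum_erase _ _ (Finset.mem_univ s)]
    have : (1 - p s) = ∑ a ∈ Finset.univ.erase s, p a := by
      rw [← hp1, ← Finset.add_sum_erase _ p (Finset.mem_univ s)]; ring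
    rw [this, Finset.sum_mul]
    gcongr with a _
    · exact (hp0 a).le
    · have := key (f a - y a)
      nlinarith
  have h4 : p s * ((f s - y s) - (γ / 4) * (y s - f s) ^ 2) + (1 - p s) * (1 / γ) + (y s - f s)
      ≤ (p s)⁻¹ * (1 / γ) := by
    have hs := hp0 s
    have e : (p s)⁻¹ * (1 / γ) - (p s * ((f s - y s) - (γ / 4) * (y s - f s) ^ 2)
        + (1 - p s) * (1 / γ) + (y s - f s))
        = (p s * γ / 2 * (y s - f s) - (1 - p s)) ^ 2 / (p s * γ) + 1 / γ := by
      field_simp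
      ring
    have : 0 ≤ (p s * γ / 2 * (y s - f s) - (1 - p s)) ^ 2 / (p s * γ) + 1 / γ := by positivity
    linarith
  have h5 : (p s)⁻¹ * (1 / γ) ≤ K / γ + (y s - y b) := by
    have : (p s)⁻¹ * (1 / γ) ≤ (K + γ * (y s - y b)) * (1 / γ) := by
      gcongr; exact hpb s
    have e : (K + γ * (y s - y b)) * (1 / γ) = K / γ + (y s - y b) := by
      field_simp
    linarith
  have : 2 * (K : ℝ) / γ = K / γ + K / γ := by ring
  linarith

theorem scb_prob (K : ℕ) (hK : 2 ≤ K) (γ : ℝ) (hγ : 0 < γ) (y : Fin K → ℝ) (b : Fin K)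
    (hb : ∀ a, y b ≤ y a) :
    (∀ a, 0 < squareCBProb K γ y b a) ∧ ∑ a, squareCBProb K γ y b a = 1 ∧
    (∀ a, (squareCBProb K γ y b a)⁻¹ ≤ K + γ * (y a - y b)) ∧
    (∀ a, squareCBProb K γ y b a * (γ * (y a - y b)) ≤ 1) := by
  have hK0 : (0 : ℝ) < K := by exact_mod_cast (by omega : 0 < K)
  have hg : ∀ a, 0 ≤ γ * (y a - y b) := fun a => mul_nonneg hγ.le (sub_nonneg.2 (hb a))
  have hbb : (K : ℝ)⁻¹ ≤ squareCBProb K γ y b b := by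
    have : ∑ a' ∈ Finset.univ.erase b, ((K : ℝ) + γ * (y a' - y b))⁻¹
        ≤ ∑ a' ∈ Finset.univ.erase b, (K : ℝ)⁻¹ := by
      refine Finset.sum_le_sum fun a _ => ?_
      exact inv_anti₀ hK0 (by linarith [hg a])
    have e : ∑ a' ∈ Finset.univ.erase b, (K : ℝ)⁻¹ = 1 - (K : ℝ)⁻¹ := by
      have h := Finset.add_sum_erase Finset.univ (fun _ : Fin K => (K : ℝ)⁻¹) (Finset.mem_univ b)
      have h' : ∑ _a : Fin K, (K : ℝ)⁻¹ = 1 := by simp [hK0.ne']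
      linarith
    simp only [squareCBProb, if_true]
    linarith
  have hne : ∀ a, a ≠ b → squareCBProb K γ y b a = ((K : ℝ) + γ * (y a - y b))⁻¹ := by
    intro a ha
    simp [squareCBProb, ha]
  have hb0 : 0 < squareCBProb K γ y b b := lt_of_lt_of_le (by positivity) hbb
  refine ⟨fun a => ?_, ?_, fun a => ?_, fun a => ?_⟩
  · by_cases ha : a = b
    · rw [ha]; exact hb0
    · rw [hne a ha]; have := hg a; positivity
  · rw [← Finset.add_sum_erase _ _ (Finset.mem_univ b)]
    rw [Finset.sum_congr rfl fun a ha => hne a (Finset.ne_of_mem_erase ha)]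
    simp [squareCBProb]
  · by_cases ha : a = b
    · rw [ha]; simpa using inv_anti₀ (by positivity) hbb
    · rw [hne a ha, inv_inv]
  · by_cases ha : a = b
    · rw [ha]; simp
    · rw [hne a ha]
      have := hg a
      rw [inv_mul_le_iff₀ (by positivity)]
      linarith

theorem scb_sup (K : ℕ) (hK : 2 ≤ K) (γ : ℝ) (hγ : 0 < γ) (yhat : Fin K → ℝ) (b : Fin K)
    (hb : ∀ a, yhat b ≤ yhat a) :
    (⨆ fstar : {f : Fin K → ℝ // ∀ a, f a ∈ Set.Icc (0 : ℝ) 1},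
          ⨆ astar : Fin K,
            ∑ a : Fin K, squareCBProb K γ yhat b a *
              (fstar.1 a - fstar.1 astar - (γ / 4) * (yhat a - fstar.1 a) ^ 2))
          ≤ 2 * K / γ := by
  obtain ⟨h0, h1, h2, h3⟩ := scb_prob K hK γ hγ yhat b hb
  have hc : (0 : ℝ) ≤ 2 * K / γ := by positivity
  exact Real.iSup_le (fun f => Real.iSup_le
    (fun s => scb_sum_bound K γ hγ yhat b _ h0 h1 h2 h3 f.1 s) hc) hc

/-- for every `K ≥ 2` and `γ > 0`, `Val(γ) ≤ 2K/γ`; in fact for every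
`ŷ ∈ [0,1]^K` the SquareCB action distribution `p = p(ŷ, γ)` certifies this:
`sup_{f*∈[0,1]^K} max_{a*} Σ_a p_a [f*_a − f*_{a*} − (γ/4)(ŷ_a − f*_a)²] ≤ 2K/γ`. -/
theorem squareCB_minimax_upper (K : ℕ) (hK : 2 ≤ K) (γ : ℝ) (hγ : 0 < γ) :
    squareCBVal K γ ≤ 2 * K / γ ∧
    ∀ (yhat : Fin K → ℝ), (∀ a, yhat a ∈ Set.Icc (0 : ℝ) 1) →
      ∀ (b : Fin K), (∀ a, yhat b ≤ yhat a) →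
        (⨆ fstar : {f : Fin K → ℝ // ∀ a, f a ∈ Set.Icc (0 : ℝ) 1},
          ⨆ astar : Fin K,
            ∑ a : Fin K, squareCBProb K γ yhat b a *
              (fstar.1 a - fstar.1 astar - (γ / 4) * (yhat a - fstar.1 a) ^ 2))
          ≤ 2 * K / γ := by
  refine ⟨?_, fun yhat _ b hb => scb_sup K hK γ hγ yhat b hb⟩
  have hc : (0 : ℝ) ≤ 2 * K / γ := by positivity
  unfold squareCBVal
  refine Real.iSup_le (fun yhat => ?_) hc
  have : Nonempty (Fin K) := ⟨⟨0, by omega⟩⟩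
  obtain ⟨b, hb⟩ := Finite.exists_min yhat.1
  by_cases hbd : BddBelow (Set.range fun p : {p : Fin K → ℝ // (∀ a, 0 ≤ p a) ∧ ∑ a, p a = 1} =>
      ⨆ fstar : {f : Fin K → ℝ // ∀ a, f a ∈ Set.Icc (0 : ℝ) 1},
        ⨆ astar : Fin K,
          ∑ a : Fin K, p.1 a *
            (fstar.1 a - fstar.1 astar - (γ / 4) * (yhat.1 a - fstar.1 a) ^ 2))
  · obtain ⟨h0, h1, _, _⟩ := scb_prob K hK γ hγ yhat.1 b hb
    exact (ciInf_le hbd ⟨squareCBProb K γ yhat.1 b, fun a => (h0 a).le, h1⟩).trans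
      (scb_sup K hK γ hγ yhat.1 b hb)
  · rw [Real.iInf_of_not_bddBelow hbd]
    exact hc
end

section
/- Let T be a positive integer such that N := √(2T) is an integer dividing T, and consider the gap-lower-bound construction with Δ = 1/4. Then for every randomized contextual bandit algorithm (a seed distribution P_r on a measurable space R together with measurable maps A_t : [0,1]^{t−1} × R → {a1, a2}, t = 1,…,T), there exists i ∈ {0,1,…,N} such that the expected regret on the noiseless instance P_i satisfies E_{r∼P_r}[ Σ_{t=1}^T f_i(x_t, a_t^i(r)) − f_i(x_t, π_i(x_t)) ] ≥ (1/16)√T, where a_t^i(r) := A_t(f_i(x_1, a_1^i(r)), …, f_i(x_{t−1}, a_{t−1}^i(r)); r) and π_i(x) := argmin_a f_i(x, a). Note that every instance P_i has uniform gap Δ = 1/4 and |F| = N + 1 ≤ √(2T) + 1. -/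
open MeasureTheory

/-- The regression functions of the gap-lower-bound construction (with `Δ = 1/4`):
instances are indexed by `i ∈ {0,1,…,N}` (`i = 0` is `f_0`, and `i = j+1` corresponds
to `f_{j+1}` for the context `j`); actions are `Bool`, with `false = a1` and
`true = a2`.  `f_i(j, a1) = 1/2 − Δ = 1/4` for all `j, i`; `f_i(j, a2) = 1/2` for
`j ≠ i` and `f_i(i, a2) = 1/2 − 2Δ = 0`; `f_0(j, a2) = 1/2` for all `j`. -/
noncomputable def gapF (N : ℕ) (i : Fin (N + 1)) (j : Fin N) (b : Bool) : ℝ :=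
  if b = false then 1 / 4 else if (i : ℕ) = (j : ℕ) + 1 then 0 else 1 / 2

/-- The fixed context sequence: context `i` (0-indexed) is played throughout the `i`-th
block of `T/N` consecutive rounds. -/
def gapCtx (T N : ℕ) (hT : 0 < T) (hN : 0 < N) : Fin T → Fin N := fun t =>
  ⟨t.val * N / T, Nat.div_lt_of_lt_mul (Nat.mul_lt_mul_of_lt_of_le t.isLt le_rfl hN)⟩

/-- The actions generated by a randomized algorithm
`A_t : [0,1]^{t-1} × R → {a1, a2}` with seed `r`, run on the noiseless instance with
regression function `loss` and the fixed context sequence: the action at round `t` is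
`A_t` applied to the losses observed at rounds `s < t`. -/
noncomputable def gapRun {R : Type*} (T N : ℕ) (hT : 0 < T) (hN : 0 < N)
    (loss : Fin N → Bool → ℝ)
    (Alg : (t : Fin T) → (Fin t.val → ℝ) → R → Bool) (r : R) :
    (t : ℕ) → t < T → Bool := fun t ht =>
  Alg ⟨t, ht⟩ (fun s => loss (gapCtx T N hT hN ⟨s.val, lt_trans s.isLt ht⟩)
    (gapRun T N hT hN loss Alg r s.val (lt_trans s.isLt ht))) r
termination_by t => t
decreasing_by exact s.isLt

lemma gapRun_meas {R : Type*} [MeasurableSpace R] (T N : ℕ) (hT : 0 < T) (hN : 0 < N)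
    (loss : Fin N → Bool → ℝ)
    (Alg : (t : Fin T) → (Fin t.val → ℝ) → R → Bool)
    (hAlg : ∀ t : Fin T, Measurable fun q : (Fin t.val → ℝ) × R => Alg t q.1 q.2)
    (t : ℕ) : ∀ ht : t < T, Measurable fun r => gapRun T N hT hN loss Alg r t ht := by
  induction t using Nat.strong_induction_on with
  | _ t ih =>
    intro ht
    have h1 : (fun r => gapRun T N hT hN loss Alg r t ht) = fun r =>
        Alg ⟨t, ht⟩ (fun s => loss (gapCtx T N hT hN ⟨s.val, lt_trans s.isLt ht⟩)
          (gapRun T N hT hN loss Alg r s.val (lt_trans s.isLt ht))) r := by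
      funext r
      rw [gapRun]
    rw [h1]
    refine (hAlg ⟨t, ht⟩).comp (Measurable.prodMk ?_ measurable_id)
    refine measurable_pi_lambda _ fun s => ?_
    exact (measurable_of_countable (loss (gapCtx T N hT hN ⟨s.val, lt_trans s.isLt ht⟩))).comp
      (ih s.val s.isLt (lt_trans s.isLt ht))

lemma gapRun_agree {R : Type*} (T N : ℕ) (hT : 0 < T) (hN : 0 < N)
    (Alg : (t : Fin T) → (Fin t.val → ℝ) → R → Bool) (r : R) (i : Fin N)
    (h : ∀ t : Fin T, gapCtx T N hT hN t = i →
      gapRun T N hT hN (gapF N 0) Alg r t.val t.isLt = false)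
    (t : ℕ) : ∀ ht : t < T, gapCtx T N hT hN ⟨t, ht⟩ ≤ i →
      gapRun T N hT hN (gapF N i.succ) Alg r t ht = gapRun T N hT hN (gapF N 0) Alg r t ht := by
  induction t using Nat.strong_induction_on with
  | _ t ih =>
    intro ht hc
    rw [gapRun, gapRun]
    congr 1
    funext s
    have hs : gapCtx T N hT hN ⟨s.val, lt_trans s.isLt ht⟩ ≤ i := by
      refine le_trans ?_ hc
      change s.val * N / T ≤ t * N / T
      exact Nat.div_le_div_right (Nat.mul_le_mul_right _ s.isLt.le)
    rw [ih s.val s.isLt (lt_trans s.isLt ht) hs]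
    by_cases he : gapCtx T N hT hN ⟨s.val, lt_trans s.isLt ht⟩ = i
    · rw [h ⟨s.val, lt_trans s.isLt ht⟩ he]
      simp [gapF]
    · have hne : ((i.succ : Fin (N+1)) : ℕ) ≠
          (gapCtx T N hT hN ⟨s.val, lt_trans s.isLt ht⟩ : ℕ) + 1 := by
        intro h'
        apply he
        ext
        simp at h'
        omega
      unfold gapF
      rw [if_neg hne]
      simp

lemma gap_card (T N M : ℕ) (hT : 0 < T) (hN : 0 < N) (hM : T = N * M) (i : Fin N) :
    M ≤ (Finset.univ.filter fun t : Fin T => gapCtx T N hT hN t = i).card := by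
  have hb : ∀ k : Fin M, i.val * M + k.val < T := by
    intro k
    have h1 := i.isLt
    have h2 := k.isLt
    have : (i.val + 1) * M ≤ N * M := Nat.mul_le_mul_right _ h1
    rw [hM]; linarith
  have := Finset.card_le_card_of_injOn (s := (Finset.univ : Finset (Fin M)))
    (t := Finset.univ.filter fun t : Fin T => gapCtx T N hT hN t = i)
    (fun k => ⟨i.val * M + k.val, hb k⟩) ?_ ?_
  · simpa using this
  · intro k _
    simp only [Finset.coe_filter, Finset.mem_univ, true_and, Set.mem_setOf_eq]
    ext
    change (i.val * M + k.val) * N / T = i.val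
    have h2 := k.isLt
    rw [hM, Nat.mul_comm N M, Nat.mul_div_mul_right _ _ hN]
    rw [Nat.div_eq_of_lt_le]
    · linarith
    · linarith
  · intro a _ b _ hab
    simp at hab
    exact Fin.ext hab

/-- Theorem `gap_lb`: let `N = √(2T)` be an integer dividing `T`
and `Δ = 1/4`.  Every instance of the construction has uniform gap `Δ = 1/4` and the
function class has size `N + 1 ≤ √(2T) + 1`; and for every randomized contextual
bandit algorithm there is an instance `i ∈ {0,…,N}` on which the expected regret is
at least `√T/16`. -/
theorem gap_lower_bound (T N : ℕ) (hT : 0 < T) (hN : 0 < N)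
    (hNval : (N : ℝ) = Real.sqrt (2 * T)) (hdvd : N ∣ T)
    {R : Type*} [MeasurableSpace R] (Pr : Measure R) [IsProbabilityMeasure Pr]
    (Alg : (t : Fin T) → (Fin t.val → ℝ) → R → Bool)
    (hAlg : ∀ t : Fin T, Measurable fun q : (Fin t.val → ℝ) × R => Alg t q.1 q.2)
    -- `π i` is the optimal policy of instance `i`
    (π : Fin (N + 1) → Fin N → Bool)
    (hπ : ∀ i j b, gapF N i j (π i j) ≤ gapF N i j b) :
    -- every instance has uniform gap Δ = 1/4
    (∀ i j b, b ≠ π i j → gapF N i j (π i j) + 1 / 4 ≤ gapF N i j b) ∧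
    -- the function class has N + 1 ≤ √(2T) + 1 elements
    ((N : ℝ) + 1 ≤ Real.sqrt (2 * T) + 1) ∧
    -- lower bound on the expected regret of some instance
    ∃ i : Fin (N + 1),
      (1 / 16 : ℝ) * Real.sqrt T ≤
        ∫ r, (∑ t : Fin T,
            (gapF N i (gapCtx T N hT hN t)
                (gapRun T N hT hN (gapF N i) Alg r t.val t.isLt)
              - gapF N i (gapCtx T N hT hN t) (π i (gapCtx T N hT hN t)))) ∂Pr := by
  have hnn : ∀ i j b, 0 ≤ gapF N i j b - gapF N i j (π i j) := fun i j b => by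
    linarith [hπ i j b]
  refine ⟨?_, by rw [hNval], ?_⟩
  · intro i j b hb
    have h1 := hπ i j b
    revert h1 hb
    cases b <;> cases hp : π i j <;> simp only [gapF] <;> split_ifs <;> norm_num at *
  obtain ⟨M, hM⟩ := hdvd
  have hsq : (N : ℝ) ^ 2 = 2 * T := by
    rw [hNval, Real.sq_sqrt (by positivity)]
  have hNM : N = 2 * M := by
    have : N ^ 2 = 2 * T := by exact_mod_cast hsq
    rw [hM] at this
    have h3 : N * N = N * (2 * M) := by linarith
    exact Nat.eq_of_mul_eq_mul_left hN h3
  have hM0 : 0 < M := by omega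
  set D : Fin (N + 1) → R → Fin T → ℝ := fun i r t =>
    gapF N i (gapCtx T N hT hN t) (gapRun T N hT hN (gapF N i) Alg r t.val t.isLt)
      - gapF N i (gapCtx T N hT hN t) (π i (gapCtx T N hT hN t)) with hD
  have hDnn : ∀ i r t, 0 ≤ D i r t := fun i r t => hnn _ _ _
  have hint : ∀ i, Integrable (fun r => ∑ t, D i r t) Pr := by
    intro i
    refine integrable_finsetSum _ fun t _ => ?_
    refine Integrable.of_bound (C := 1) ?_ ?_
    · apply Measurable.aestronglyMeasurable
      exact ((measurable_of_countable (gapF N i (gapCtx T N hT hN t))).comp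
        (gapRun_meas T N hT hN (gapF N i) Alg hAlg t.val t.isLt)).sub_const _
    · refine Filter.Eventually.of_forall fun r => ?_
      rw [Real.norm_eq_abs, abs_of_nonneg (hDnn i r t)]
      have hbd : ∀ j b, 0 ≤ gapF N i j b ∧ gapF N i j b ≤ 1 := by
        intro j b
        unfold gapF
        split_ifs <;> norm_num
      have h1 := (hbd (gapCtx T N hT hN t) (gapRun T N hT hN (gapF N i) Alg r t.val t.isLt)).2
      have h2 := (hbd (gapCtx T N hT hN t) (π i (gapCtx T N hT hN t))).1
      simp only [hD]
      linarith
  have key : ∀ r (i : Fin N), (M : ℝ) / 4 ≤ ∑ t, D i.succ r t +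
      M * ∑ t with gapCtx T N hT hN t = i, D 0 r t := by
    intro r i
    have hA : 0 ≤ ∑ t, D i.succ r t := Finset.sum_nonneg fun t _ => hDnn _ _ _
    by_cases h : ∀ t : Fin T, gapCtx T N hT hN t = i →
      gapRun T N hT hN (gapF N 0) Alg r t.val t.isLt = false
    · have hB : 0 ≤ ∑ t with gapCtx T N hT hN t = i, D 0 r t :=
        Finset.sum_nonneg fun t _ => hDnn _ _ _
      have hC : ∑ t with gapCtx T N hT hN t = i, D i.succ r t ≤ ∑ t, D i.succ r t :=
        Finset.sum_le_sum_of_subset_of_nonneg (Finset.filter_subset _ _) fun t _ _ => hDnn _ _ _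
      have hE := Finset.card_nsmul_le_sum
        (Finset.univ.filter fun t : Fin T => gapCtx T N hT hN t = i) (D i.succ r) (1 / 4) (by
          intro t ht
          have ht' : gapCtx T N hT hN t = i := by simpa using ht
          have h1 := gapRun_agree T N hT hN Alg r i h t.val t.isLt ht'.le
          rw [h t ht'] at h1
          have h2 := hπ i.succ i true
          simp only [hD, ht', h1]
          have h3 : gapF N i.succ i true = 0 := by simp [gapF]
          have h4 : gapF N i.succ i false = 1 / 4 := by simp [gapF]
          linarith)
      have hF : (M : ℝ) ≤ _ := Nat.cast_le.mpr (gap_card T N M hT hN hM i)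
      rw [nsmul_eq_mul] at hE
      have : 0 ≤ (M : ℝ) * ∑ t with gapCtx T N hT hN t = i, D 0 r t := by positivity
      linarith
    · push Not at h
      obtain ⟨t, ht, hr⟩ := h
      have h1 : D 0 r t ≤ ∑ t with gapCtx T N hT hN t = i, D 0 r t :=
        Finset.single_le_sum (f := D 0 r) (fun t _ => hDnn _ _ _) (by simpa using ht)
      have h2 : 1 / 4 ≤ D 0 r t := by
        have hr' : gapRun T N hT hN (gapF N 0) Alg r t.val t.isLt = true := by simpa using hr
        have h3 := hπ 0 i false
        simp only [hD, ht, hr']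
        have h4 : gapF N 0 i true = 1 / 2 := by simp [gapF]
        have h5 : gapF N 0 i false = 1 / 4 := by simp [gapF]
        linarith
      have := mul_le_mul_of_nonneg_left (h2.trans h1) (Nat.cast_nonneg (α := ℝ) M)
      linarith
  have key2 : ∀ r, (N : ℝ) * (M / 4) ≤ ∑ i : Fin N, ∑ t, D i.succ r t + M * ∑ t, D 0 r t := by
    intro r
    have h := Finset.sum_le_sum fun (i : Fin N) (_ : i ∈ Finset.univ) => key r i
    rw [Finset.sum_add_distrib, ← Finset.mul_sum, Finset.sum_fiberwise] at h
    simpa using h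
  have hI : (N : ℝ) * (M / 4) ≤ ∑ i : Fin N, ∫ r, ∑ t, D i.succ r t ∂Pr
      + M * ∫ r, ∑ t, D 0 r t ∂Pr := by
    rw [← integral_finsetSum _ fun i _ => hint (Fin.succ i), ← integral_const_mul,
      ← integral_add (integrable_finsetSum _ fun i _ => hint (Fin.succ i))
        ((hint 0).const_mul _)]
    have := integral_mono (μ := Pr) (integrable_const ((N : ℝ) * (M / 4)))
      ((integrable_finsetSum _ fun i _ => hint (Fin.succ i)).add ((hint 0).const_mul (M : ℝ))) key2
    simpa using this
  by_contra hcon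
  push Not at hcon
  have hs : ∑ i : Fin N, ∫ r, ∑ t, D i.succ r t ∂Pr ≤ N * (1 / 16 * Real.sqrt T) := by
    have := Finset.sum_le_sum fun (i : Fin N) (_ : i ∈ Finset.univ) => (hcon i.succ).le
    refine le_trans this (le_of_eq ?_)
    rw [Finset.sum_const, Finset.card_univ, Fintype.card_fin, nsmul_eq_mul]
  have h0 := mul_le_mul_of_nonneg_left (hcon 0).le (Nat.cast_nonneg (α := ℝ) M)
  have hNr : (N : ℝ) = 2 * M := by exact_mod_cast hNM
  have hMr : (0 : ℝ) < M := by exact_mod_cast hM0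
  have hsT : Real.sqrt T ≤ 2 * M := by
    rw [← hNr, hNval]
    exact Real.sqrt_le_sqrt (by linarith [Nat.cast_nonneg (α := ℝ) T])
  have h7 := mul_le_mul_of_nonneg_left hsT hMr.le
  rw [hNr] at hI hs
  have h0' : (M : ℝ) * ∫ r, ∑ t, D 0 r t ∂Pr ≤ M * (1 / 16 * Real.sqrt T) := h0
  nlinarith
end

section
/- In the gap-lower-bound construction, fix a randomized algorithm given by a seed distribution P_r on a measurable space R and measurable maps A_t : [0,1]^{t−1} × R → {a1, a2}. For instance j ∈ {0,1,…,N}, let a_t^j(r) := A_t(f_j(x_1, a_1^j(r)), …, f_j(x_{t−1}, a_{t−1}^j(r)); r) denote the actions generated on instance P_j. For i ∈ [N], let I_i := {t : x_t = i}. Then for every i ∈ [N], P_r( a_t^0(r) = a1 for all t ∈ I_i ) = P_r( a_t^i(r) = a1 for all t ∈ I_i ). -/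
open MeasureTheory

theorem gapRun_congr_aux {R : Type*} (T N : ℕ) (hT : 0 < T) (hN : 0 < N)
    (L L' : Fin N → Bool → ℝ) (Alg : (t : Fin T) → (Fin t.val → ℝ) → R → Bool) (r : R)
    (i : Fin N) (h1 : ∀ j b, j ≠ i → L j b = L' j b) (h2 : L i false = L' i false)
    (h : ∀ t : Fin T, gapCtx T N hT hN t = i →
      gapRun T N hT hN L Alg r t.val t.isLt = false) (t : ℕ) :
    ∀ ht : t < T, gapRun T N hT hN L Alg r t ht = gapRun T N hT hN L' Alg r t ht := by
  induction t using Nat.strong_induction_on with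
  | _ t ih =>
    intro ht
    rw [gapRun, gapRun]
    congr 1
    funext s
    rw [← ih s.val s.isLt (lt_trans s.isLt ht)]
    by_cases hc : gapCtx T N hT hN ⟨s.val, lt_trans s.isLt ht⟩ = i
    · have h3 := h _ hc
      simp only at h3
      rw [h3, hc, h2]
    · exact h1 _ _ hc

/-- Lemma `instance_relation`: for every randomized algorithm and
every `i ∈ [N]`, the probability (over the seed) that the algorithm plays `a1` on the
whole block `I_i = {t : x_t = i}` is the same under instance `P_0` and under
instance `P_i`. -/
theorem gap_instance_relation (T N : ℕ) (hT : 0 < T) (hN : 0 < N) (hdvd : N ∣ T)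
    {R : Type*} [MeasurableSpace R] (Pr : Measure R) [IsProbabilityMeasure Pr]
    (Alg : (t : Fin T) → (Fin t.val → ℝ) → R → Bool)
    (hAlg : ∀ t : Fin T, Measurable fun q : (Fin t.val → ℝ) × R => Alg t q.1 q.2)
    (i : Fin N) :
    Pr {r | ∀ t : Fin T, gapCtx T N hT hN t = i →
        gapRun T N hT hN (gapF N 0) Alg r t.val t.isLt = false}
      = Pr {r | ∀ t : Fin T, gapCtx T N hT hN t = i →
        gapRun T N hT hN (gapF N i.succ) Alg r t.val t.isLt = false} := by
  have h1 : ∀ j b, j ≠ i → gapF N 0 j b = gapF N i.succ j b := by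
    intro j b hj
    have : (i : ℕ) ≠ (j : ℕ) := fun h => hj (Fin.ext h.symm)
    simp [gapF, this]
  have h2 : gapF N 0 i false = gapF N i.succ i false := by simp [gapF]
  congr 1
  ext r
  constructor
  · intro h t ht
    rw [← gapRun_congr_aux T N hT hN _ _ Alg r i h1 h2 h]
    exact h t ht
  · intro h t ht
    rw [← gapRun_congr_aux T N hT hN _ _ Alg r i (fun j b hj => (h1 j b hj).symm) h2.symm h]
    exact h t ht
end

section
/- Let I be a set of n consecutive rounds. Suppose the contexts (x_t)_{t∈I} are drawn i.i.d. from a distribution μ on X, and on a filtration (F_t) with F_{t−1} = σ((x_1,a_1,ℓ_1(a_1)),…,(x_{t−1},a_{t−1},ℓ_{t−1}(a_{t−1}))) the losses ℓ_t : [K] → [0,1] satisfy E[ℓ_t(a) | F_{t−1}, x_t] = f*(x_t, a), the action a_t is drawn from a distribution p_t measurable with respect to (F_{t−1}, x_t), ℓ_t is conditionally independent of a_t given (F_{t−1}, x_t), and the predictions ŷ_t ∈ [0,1] are measurable with respect to (F_{t−1}, x_t, a_t). Fix f : X × [K] → [0,1]. Then for every δ ∈ (0,1), with probability at least 1 − δ: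 Σ_{t∈I} [(ŷ_t − ℓ_t(a_t))² − (f*(x_t,a_t) − ℓ_t(a_t))²] ≤ Σ_{t∈I} [(ŷ_t − ℓ_t(a_t))² − (f(x_t,a_t) − ℓ_t(a_t))²] + 2Kn · max_{a∈[K]} E_{x∼μ}[(f(x,a) − f*(x,a))²] + 16 log(1/δ). -/
open MeasureTheory ProbabilityTheory Finset

/-- The filtration of the epoch: `epochFilt x a ℓ t` is
`F_{t-1} = σ((x_1,a_1,ℓ_1(a_1)), …, (x_{t-1},a_{t-1},ℓ_{t-1}(a_{t-1})))`
(rounds indexed from `0`; this one does **not** include the current context). -/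
def epochFilt {Ω X : Type*} [MeasurableSpace X] {K : ℕ}
    (x : ℕ → Ω → X) (a : ℕ → Ω → Fin K) (ℓ : ℕ → Ω → Fin K → ℝ) (t : ℕ) :
    MeasurableSpace Ω :=
  ⨆ s ∈ Set.Iio t,
    (MeasurableSpace.comap (x s) inferInstance ⊔
      MeasurableSpace.comap (a s) inferInstance ⊔
      MeasurableSpace.comap (fun ω => ℓ s ω (a s ω)) inferInstance)

/-- The σ-algebra `σ(F_{t-1}, x_t)`. -/
def epochFiltX {Ω X : Type*} [MeasurableSpace X] {K : ℕ}
    (x : ℕ → Ω → X) (a : ℕ → Ω → Fin K) (ℓ : ℕ → Ω → Fin K → ℝ) (t : ℕ) :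
    MeasurableSpace Ω :=
  epochFilt x a ℓ t ⊔ MeasurableSpace.comap (x t) inferInstance

lemma aux_int {Ω : Type*} [m0 : MeasurableSpace Ω] {μ : Measure Ω} [IsProbabilityMeasure μ]
    {U : Ω → ℝ} (hU : Measurable U) {C : ℝ} (h : ∀ ω, |U ω| ≤ C) : Integrable U μ :=
  Integrable.of_bound hU.aestronglyMeasurable C (Filter.Eventually.of_forall h)

lemma aux_condMul {Ω : Type*} {G : MeasurableSpace Ω} [m0 : MeasurableSpace Ω] [StandardBorelSpace Ω]
    {μ : Measure Ω} [IsProbabilityMeasure μ] (hG : G ≤ m0)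
    {U V : Ω → ℝ} (hU : Measurable U) (hV : Measurable V)
    (hU1 : ∀ ω, |U ω| ≤ 1) (hV1 : ∀ ω, |V ω| ≤ 1)
    (h : CondIndepFun G hG U V μ) :
    μ[fun ω => U ω * V ω | G] =ᵐ[μ] fun ω => (μ[U | G]) ω * (μ[V | G]) ω := by
  have hUV : Integrable (fun ω => U ω * V ω) μ := by
    refine aux_int (hU.mul hV) (C := 1) (fun ω => ?_)
    rw [abs_mul]
    exact mul_le_one₀ (hU1 ω) (abs_nonneg _) (hV1 ω)
  have h1 := condExp_ae_eq_integral_condExpKernel hG hUV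
  have h2 := condExp_ae_eq_integral_condExpKernel hG (aux_int (μ := μ) hU hU1)
  have h3 := condExp_ae_eq_integral_condExpKernel hG (aux_int (μ := μ) hV hV1)
  have h4 := ae_of_ae_trim hG ((condIndepFun_iff_map_prod_eq_prod_map_map hU hV).1 h)
  filter_upwards [h1, h2, h3, h4] with ω e1 e2 e3 e4
  rw [e1, e2, e3]
  have hi : IndepFun U V (condExpKernel μ G ω) := by
    rw [indepFun_iff_map_prod_eq_prod_map_map hU.aemeasurable hV.aemeasurable]
    rwa [Kernel.map_apply _ (hU.prodMk hV), Kernel.prod_apply, Kernel.map_apply _ hU,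
      Kernel.map_apply _ hV] at e4
  exact hi.integral_fun_mul_eq_mul_integral hU.aestronglyMeasurable hV.aestronglyMeasurable

lemma aux_zero {Ω : Type*} {G : MeasurableSpace Ω} [m0 : MeasurableSpace Ω] [StandardBorelSpace Ω]
    {μ : Measure Ω} [IsProbabilityMeasure μ] (hG : G ≤ m0)
    {U V H s : Ω → ℝ} (hU : Measurable U) (hV : Measurable V)
    (hU1 : ∀ ω, |U ω| ≤ 1) (hV1 : ∀ ω, |V ω| ≤ 1)
    (h : CondIndepFun G hG U V μ) (hs : Measurable[G] s) (hs1 : ∀ ω, |s ω| ≤ 1)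
    (hc : μ[U | G] =ᵐ[μ] s) (hH : Measurable[G] H) {C : ℝ} (hHC : ∀ ω, |H ω| ≤ C) :
    ∫ ω, H ω * (V ω * (s ω - U ω)) ∂μ = 0 := by
  have hH' : Measurable H := hH.mono hG le_rfl
  have hs' : Measurable s := hs.mono hG le_rfl
  have hb : ∀ {A B : Ω → ℝ} {a b : ℝ}, (∀ ω, |A ω| ≤ a) → (∀ ω, |B ω| ≤ b) →
      ∀ ω, |A ω * B ω| ≤ a * b := by
    intro A B a b hA hB ω
    rw [abs_mul]
    exact mul_le_mul (hA ω) (hB ω) (abs_nonneg _) ((abs_nonneg _).trans (hA ω))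
  have iUV : Integrable (fun ω => U ω * V ω) μ := aux_int (hU.mul hV) (hb hU1 hV1)
  have iHUV : Integrable (fun ω => H ω * (U ω * V ω)) μ :=
    aux_int (hH'.mul (hU.mul hV)) (hb hHC (hb hU1 hV1))
  have iHsV : Integrable (fun ω => (H ω * s ω) * V ω) μ :=
    aux_int ((hH'.mul hs').mul hV) (hb (hb hHC hs1) hV1)
  have e1 : ∫ ω, H ω * (U ω * V ω) ∂μ = ∫ ω, (H ω * s ω) * (μ[V | G]) ω ∂μ := by
    rw [← integral_condExp hG]
    apply integral_congr_ae
    filter_upwards [condExp_mul_of_stronglyMeasurable_left hH.stronglyMeasurable iHUV iUV,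
      aux_condMul hG hU hV hU1 hV1 h, hc] with ω a1 a2 a3
    refine a1.trans ?_
    simp only [Pi.mul_apply]
    rw [a2, a3]; ring
  have e2 : ∫ ω, (H ω * s ω) * V ω ∂μ = ∫ ω, (H ω * s ω) * (μ[V | G]) ω ∂μ := by
    rw [← integral_condExp hG]
    apply integral_congr_ae
    filter_upwards [condExp_mul_of_stronglyMeasurable_left (hH.mul hs).stronglyMeasurable
      iHsV (aux_int hV hV1)] with ω a1
    exact a1
  have : (fun ω => H ω * (V ω * (s ω - U ω))) =
      fun ω => (H ω * s ω) * V ω - H ω * (U ω * V ω) := by ext ω; ring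
  rw [this, integral_sub iHsV iHUV, e1, e2, sub_self]

lemma aux_pt {f g l : ℝ} (hf : f ∈ Set.Icc (0 : ℝ) 1) (hg : g ∈ Set.Icc (0 : ℝ) 1)
    (hl : l ∈ Set.Icc (0 : ℝ) 1) :
    Real.exp (1 / 16 * ((f - l) ^ 2 - (g - l) ^ 2)) ≤
      1 + 1 / 8 * (f - g) ^ 2 + 1 / 8 * ((f - g) * (g - l)) := by
  obtain ⟨f0, f1⟩ := hf
  obtain ⟨g0, g1⟩ := hg
  obtain ⟨l0, l1⟩ := hl
  have hz : |1 / 16 * ((f - l) ^ 2 - (g - l) ^ 2)| ≤ 1 := by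
    rw [abs_le]; constructor <;> nlinarith
  have h1 := (abs_le.1 (Real.abs_exp_sub_one_sub_id_le hz)).2
  have h2 : (f + g - 2 * l) ^ 2 ≤ 4 := by nlinarith
  have h3 : ((f - l) ^ 2 - (g - l) ^ 2) ^ 2 ≤ 4 * (f - g) ^ 2 := by
    have : ((f - l) ^ 2 - (g - l) ^ 2) ^ 2 = (f + g - 2 * l) ^ 2 * (f - g) ^ 2 := by ring
    rw [this]
    exact mul_le_mul_of_nonneg_right h2 (sq_nonneg _)
  nlinarith [sq_nonneg (f - g)]

lemma aux_step {Ω X : Type*} {F G : MeasurableSpace Ω} [m0 : MeasurableSpace Ω] [MeasurableSpace X] [StandardBorelSpace Ω]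
    {μ : Measure Ω} [IsProbabilityMeasure μ] {ν : Measure X} [IsProbabilityMeasure ν]
    {K : ℕ} (hG : G ≤ m0) (hFG : F ≤ G)
    {x : Ω → X} {a : Ω → Fin K} {l : Ω → Fin K → ℝ} {g f : X → Fin K → ℝ}
    (hx : Measurable[G] x) (ha : Measurable a) (hl : Measurable l)
    (hgm : ∀ i, Measurable (fun c => g c i)) (hfm : ∀ i, Measurable (fun c => f c i))
    (hl01 : ∀ ω i, l ω i ∈ Set.Icc (0 : ℝ) 1)
    (hg01 : ∀ c i, g c i ∈ Set.Icc (0 : ℝ) 1)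
    (hf01 : ∀ c i, f c i ∈ Set.Icc (0 : ℝ) 1)
    (hlaw : Measure.map x μ = ν)
    (hindep : Indep (MeasurableSpace.comap x inferInstance) F μ)
    (hreal : ∀ i, μ[(fun ω => l ω i) | G] =ᵐ[μ] fun ω => g (x ω) i)
    (hci : CondIndepFun G hG l a μ)
    {W : Ω → ℝ} (hW : Measurable[F] W) {C : ℝ} (hW0 : ∀ ω, 0 ≤ W ω) (hWC : ∀ ω, W ω ≤ C)
    {M : ℝ} (hM : ∀ i, ∫ c, (f c i - g c i) ^ 2 ∂ν ≤ M) :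
    ∫ ω, W ω * Real.exp (1 / 16 * ((f (x ω) (a ω) - l ω (a ω)) ^ 2
      - (g (x ω) (a ω) - l ω (a ω)) ^ 2)) ∂μ ≤ Real.exp (1 / 8 * (K * M)) * ∫ ω, W ω ∂μ := by
  classical
  have hx' : Measurable x := hx.mono hG le_rfl
  have hWG : Measurable[G] W := hW.mono hFG le_rfl
  have hW' : Measurable W := hWG.mono hG le_rfl
  have hWabs : ∀ ω, |W ω| ≤ C := fun ω => by rw [abs_of_nonneg (hW0 ω)]; exact hWC ω
  have hb : ∀ {A B : Ω → ℝ} {a b : ℝ}, (∀ ω, |A ω| ≤ a) → (∀ ω, |B ω| ≤ b) →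
      ∀ ω, |A ω * B ω| ≤ a * b := by
    intro A B a b hA hB ω
    rw [abs_mul]
    exact mul_le_mul (hA ω) (hB ω) (abs_nonneg _) ((abs_nonneg _).trans (hA ω))
  have hd : ∀ c i, |f c i - g c i| ≤ 1 := fun c i => by
    have := hf01 c i; have := hg01 c i
    simp only [Set.mem_Icc] at *
    rw [abs_le]; constructor <;> linarith
  have hd2 : ∀ c i, |(f c i - g c i) ^ 2| ≤ 1 := fun c i => by
    rw [abs_pow]; exact pow_le_one₀ (abs_nonneg _) (hd c i)
  have hl1 : ∀ ω i, |l ω i| ≤ 1 := fun ω i => by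
    have := hl01 ω i
    simp only [Set.mem_Icc] at *
    rw [abs_le]; constructor <;> linarith
  have hg1 : ∀ ω i, |g ω i| ≤ 1 := fun ω i => by
    have := hg01 ω i
    simp only [Set.mem_Icc] at *
    rw [abs_le]; constructor <;> linarith
  have hgl : ∀ ω i, |g (x ω) i - l ω i| ≤ 1 := fun ω i => by
    have := hl01 ω i; have := hg01 (x ω) i
    simp only [Set.mem_Icc] at *
    rw [abs_le]; constructor <;> linarith
  have hlm : ∀ i, Measurable (fun ω => l ω i) := fun i => (measurable_pi_apply i).comp hl
  have hgx : ∀ i, Measurable[G] (fun ω => g (x ω) i) := fun i => (hgm i).comp hx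
  have hfx : ∀ i, Measurable[G] (fun ω => f (x ω) i) := fun i => (hfm i).comp hx
  let V : Fin K → Ω → ℝ := fun i ω => if a ω = i then 1 else 0
  have hVm : ∀ i, Measurable (V i) := fun i =>
    (measurable_of_finite (fun j : Fin K => if j = i then (1 : ℝ) else 0)).comp ha
  have hV1 : ∀ i ω, |V i ω| ≤ 1 := fun i ω => by
    simp only [V]; split_ifs <;> simp
  -- integrability
  have iW : Integrable W μ := aux_int hW' hWabs
  have iA : ∀ i, Integrable (fun ω => W ω * (f (x ω) i - g (x ω) i) ^ 2) μ := fun i =>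
    aux_int (hW'.mul ((((hfx i).sub (hgx i)).pow_const 2).mono hG le_rfl))
      (hb hWabs (fun ω => hd2 (x ω) i))
  have iB : ∀ i, Integrable (fun ω => (W ω * (f (x ω) i - g (x ω) i)) *
      (V i ω * (g (x ω) i - l ω i))) μ := fun i =>
    aux_int (((hWG.mul ((hfx i).sub (hgx i))).mono hG le_rfl).mul
      ((hVm i).mul (((hgx i).mono hG le_rfl).sub (hlm i))))
      (hb (hb hWabs (fun ω => hd (x ω) i)) (hb (hV1 i) (fun ω => hgl ω i)))
  have zB : ∀ i, ∫ ω, (W ω * (f (x ω) i - g (x ω) i)) * (V i ω * (g (x ω) i - l ω i)) ∂μ = 0 := by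
    intro i
    refine aux_zero hG (hlm i) (hVm i) (fun ω => hl1 ω i) (hV1 i) ?_ (hgx i)
      (fun ω => hg1 (x ω) i) (hreal i) (hWG.mul ((hfx i).sub (hgx i)))
      (hb hWabs (fun ω => hd (x ω) i))
    exact hci.comp (measurable_pi_apply i)
      (measurable_of_finite (fun j : Fin K => if j = i then (1 : ℝ) else 0))
  have hEW : 0 ≤ ∫ ω, W ω ∂μ := integral_nonneg hW0
  have zA : ∀ i, ∫ ω, W ω * (f (x ω) i - g (x ω) i) ^ 2 ∂μ ≤ (∫ ω, W ω ∂μ) * M := by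
    intro i
    have hmm : Measurable (fun c => (f c i - g c i) ^ 2) := ((hfm i).sub (hgm i)).pow_const 2
    have hi : IndepFun x W μ := by
      rw [IndepFun_iff_Indep]
      exact indep_of_indep_of_le_right hindep hW.comap_le
    have hi2 : IndepFun W (fun ω => (f (x ω) i - g (x ω) i) ^ 2) μ :=
      (hi.comp hmm measurable_id).symm
    rw [hi2.integral_fun_mul_eq_mul_integral hW'.aestronglyMeasurable
      (hmm.comp hx').aestronglyMeasurable]
    refine mul_le_mul_of_nonneg_left ?_ hEW
    refine le_trans (le_of_eq ?_) (hM i)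
    rw [← hlaw, integral_map hx'.aemeasurable hmm.aestronglyMeasurable]
  have iAs : Integrable (fun ω => 1 / 8 * ∑ i, W ω * (f (x ω) i - g (x ω) i) ^ 2) μ :=
    (integrable_finsetSum _ fun i _ => iA i).const_mul _
  have iBs : Integrable (fun ω => 1 / 8 * ∑ i, (W ω * (f (x ω) i - g (x ω) i)) *
      (V i ω * (g (x ω) i - l ω i))) μ :=
    (integrable_finsetSum _ fun i _ => iB i).const_mul _
  have iC : Integrable (fun ω => W ω + 1 / 8 * ∑ i, W ω * (f (x ω) i - g (x ω) i) ^ 2) μ :=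
    iW.add iAs
  calc _ ≤ ∫ ω, (W ω + 1 / 8 * ∑ i, W ω * (f (x ω) i - g (x ω) i) ^ 2) +
        1 / 8 * ∑ i, (W ω * (f (x ω) i - g (x ω) i)) * (V i ω * (g (x ω) i - l ω i)) ∂μ := by
        refine integral_mono_of_nonneg (Filter.Eventually.of_forall fun ω =>
          mul_nonneg (hW0 ω) (Real.exp_pos _).le) ?_ (Filter.Eventually.of_forall fun ω => ?_)
        · exact iC.add iBs
        · have p1 := mul_le_mul_of_nonneg_left
            (aux_pt (hf01 (x ω) (a ω)) (hg01 (x ω) (a ω)) (hl01 ω (a ω))) (hW0 ω)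
          refine p1.trans ?_
          have p2 : W ω * (f (x ω) (a ω) - g (x ω) (a ω)) ^ 2 ≤
              ∑ i, W ω * (f (x ω) i - g (x ω) i) ^ 2 :=
            Finset.single_le_sum (f := fun i => W ω * (f (x ω) i - g (x ω) i) ^ 2)
              (fun i _ => mul_nonneg (hW0 ω) (sq_nonneg _)) (Finset.mem_univ (a ω))
          have p3 : ∑ i, (W ω * (f (x ω) i - g (x ω) i)) * (V i ω * (g (x ω) i - l ω i)) =
              (W ω * (f (x ω) (a ω) - g (x ω) (a ω))) * (g (x ω) (a ω) - l ω (a ω)) := by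
            rw [Finset.sum_eq_single (a ω)]
            · simp [V]
            · intro b _ hb
              simp [V, Ne.symm hb]
            · simp
          beta_reduce
          rw [p3]
          nlinarith
    _ = (∫ ω, W ω ∂μ) + 1 / 8 * ∑ i, ∫ ω, W ω * (f (x ω) i - g (x ω) i) ^ 2 ∂μ := by
        rw [integral_add iC iBs, integral_add iW iAs,
          integral_const_mul, integral_const_mul, integral_finsetSum _ (fun i _ => iA i),
          integral_finsetSum _ (fun i _ => iB i)]
        simp [zB]
    _ ≤ (∫ ω, W ω ∂μ) + 1 / 8 * ∑ i : Fin K, (∫ ω, W ω ∂μ) * M := by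
        gcongr with i; exact zA i
    _ = (1 / 8 * (K * M) + 1) * ∫ ω, W ω ∂μ := by
        simp; ring
    _ ≤ _ := mul_le_mul_of_nonneg_right (Real.add_one_le_exp _) hEW

/-- Lemma `single_function_conc`: over `n` consecutive rounds with
i.i.d. contexts `x_t ∼ ν`, realizable losses, actions sampled from `σ(F_{t-1},x_t)`-
measurable distributions `p_t` (with `ℓ_t` conditionally independent of `a_t` given
`σ(F_{t-1},x_t)`), and predictions `ŷ_t ∈ [0,1]` measurable with respect to
`σ(F_{t-1},x_t,a_t)`, for every fixed `f : X × [K] → [0,1]` and `δ ∈ (0,1)`, with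
probability at least `1 − δ`:
`Σ_t [(ŷ_t − ℓ_t(a_t))² − (f*(x_t,a_t) − ℓ_t(a_t))²]
  ≤ Σ_t [(ŷ_t − ℓ_t(a_t))² − (f(x_t,a_t) − ℓ_t(a_t))²]
    + 2Kn·max_a E_{x∼ν}[(f(x,a) − f*(x,a))²] + 16 log(1/δ)`. -/
theorem single_function_concentration
    {Ω X : Type*} [m0 : MeasurableSpace Ω] [MeasurableSpace X] [StandardBorelSpace Ω]
    (μ : Measure Ω) [IsProbabilityMeasure μ]
    (ν : Measure X) [IsProbabilityMeasure ν]
    (K n : ℕ) (hK : 1 ≤ K) (hn : 1 ≤ n)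
    (x : ℕ → Ω → X) (a : ℕ → Ω → Fin K) (ℓ : ℕ → Ω → Fin K → ℝ)
    (yhat : ℕ → Ω → ℝ) (p : ℕ → Ω → Fin K → ℝ)
    (fstar f : X → Fin K → ℝ)
    (hle : ∀ t, epochFiltX x a ℓ t ≤ m0)
    (hxm : ∀ t, Measurable (x t)) (ham : ∀ t, Measurable (a t))
    (hℓm : ∀ t, Measurable (fun ω => ℓ t ω))
    (hfstarm : ∀ i, Measurable (fun c => fstar c i))
    (hfm : ∀ i, Measurable (fun c => f c i))
    -- ranges
    (hℓ01 : ∀ t ω i, ℓ t ω i ∈ Set.Icc (0 : ℝ) 1)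
    (hfstar01 : ∀ c i, fstar c i ∈ Set.Icc (0 : ℝ) 1)
    (hf01 : ∀ c i, f c i ∈ Set.Icc (0 : ℝ) 1)
    (hy01 : ∀ t ω, yhat t ω ∈ Set.Icc (0 : ℝ) 1)
    -- contexts are i.i.d. from ν: x_t has law ν and is independent of F_{t-1}
    (hlaw : ∀ t, t < n → Measure.map (x t) μ = ν)
    (hindep : ∀ t, t < n →
      Indep (MeasurableSpace.comap (x t) inferInstance) (epochFilt x a ℓ t) μ)
    -- realizability: E[ℓ_t(i) | F_{t-1}, x_t] = f*(x_t, i)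
    (hreal : ∀ t, t < n → ∀ i,
      μ[(fun ω => ℓ t ω i) | epochFiltX x a ℓ t] =ᵐ[μ] fun ω => fstar (x t ω) i)
    -- ℓ_t is conditionally independent of a_t given (F_{t-1}, x_t)
    (hci : ∀ t, t < n →
      CondIndepFun (epochFiltX x a ℓ t) (hle t) (fun ω => ℓ t ω) (a t) μ)
    -- a_t is sampled from the (F_{t-1}, x_t)-measurable distribution p_t
    (hpm : ∀ t, Measurable[epochFiltX x a ℓ t] (fun ω => p t ω))
    (hp0 : ∀ t ω i, 0 ≤ p t ω i) (hp1 : ∀ t ω, ∑ i, p t ω i = 1)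
    (hsamp : ∀ t, t < n → ∀ g : Fin K → ℝ,
      μ[(fun ω => g (a t ω)) | epochFiltX x a ℓ t] =ᵐ[μ] fun ω => ∑ i, p t ω i * g i)
    -- predictions ŷ_t are measurable with respect to (F_{t-1}, x_t, a_t)
    (hym : ∀ t, Measurable[epochFiltX x a ℓ t ⊔ MeasurableSpace.comap (a t) inferInstance]
      (yhat t))
    (δ : ℝ) (hδ : δ ∈ Set.Ioo (0 : ℝ) 1) :
    ENNReal.ofReal (1 - δ) ≤
      μ {ω | ∑ t ∈ Finset.range n,
              ((yhat t ω - ℓ t ω (a t ω)) ^ 2 - (fstar (x t ω) (a t ω) - ℓ t ω (a t ω)) ^ 2)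
            ≤ (∑ t ∈ Finset.range n,
                ((yhat t ω - ℓ t ω (a t ω)) ^ 2 - (f (x t ω) (a t ω) - ℓ t ω (a t ω)) ^ 2))
              + 2 * K * n * (⨆ i : Fin K, ∫ c, (f c i - fstar c i) ^ 2 ∂ν)
              + 16 * Real.log (1 / δ)} := by
  classical
  obtain ⟨hδ0, hδ1⟩ := hδ
  set M : ℝ := ⨆ i : Fin K, ∫ c, (f c i - fstar c i) ^ 2 ∂ν with hMdef
  have hM : ∀ i, ∫ c, (f c i - fstar c i) ^ 2 ∂ν ≤ M := fun i =>
    le_ciSup (f := fun i : Fin K => ∫ c, (f c i - fstar c i) ^ 2 ∂ν) (Set.finite_range _).bddAbove i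
  let Z : ℕ → Ω → ℝ := fun t ω => (f (x t ω) (a t ω) - ℓ t ω (a t ω)) ^ 2
    - (fstar (x t ω) (a t ω) - ℓ t ω (a t ω)) ^ 2
  have hZb : ∀ t ω, |Z t ω| ≤ 1 := by
    intro t ω
    have h1 := hf01 (x t ω) (a t ω)
    have h2 := hfstar01 (x t ω) (a t ω)
    have h3 := hℓ01 t ω (a t ω)
    simp only [Set.mem_Icc] at h1 h2 h3
    simp only [Z]
    rw [abs_le]; constructor <;> nlinarith
  have hFG : ∀ t, epochFilt x a ℓ t ≤ epochFiltX x a ℓ t := fun t => le_sup_left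
  have hZm : ∀ s t, s < t → Measurable[epochFilt x a ℓ t] (Z s) := by
    intro s t hst
    have hle' : (MeasurableSpace.comap (x s) inferInstance ⊔
      MeasurableSpace.comap (a s) inferInstance ⊔
      MeasurableSpace.comap (fun ω => ℓ s ω (a s ω)) inferInstance) ≤ epochFilt x a ℓ t :=
      le_iSup₂_of_le (f := fun s (_ : s ∈ Set.Iio t) => (MeasurableSpace.comap (x s) inferInstance ⊔
      MeasurableSpace.comap (a s) inferInstance ⊔
      MeasurableSpace.comap (fun ω => ℓ s ω (a s ω)) inferInstance)) s hst le_rfl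
    have mx : Measurable[epochFilt x a ℓ t] (x s) :=
      measurable_iff_comap_le.2 ((le_sup_left.trans le_sup_left).trans hle')
    have ma : Measurable[epochFilt x a ℓ t] (a s) :=
      measurable_iff_comap_le.2 ((le_sup_right.trans le_sup_left).trans hle')
    have ml : Measurable[epochFilt x a ℓ t] (fun ω => ℓ s ω (a s ω)) :=
      measurable_iff_comap_le.2 (le_sup_right.trans hle')
    have key : ∀ h : X → Fin K → ℝ, (∀ i, Measurable (fun c => h c i)) →
        Measurable[epochFilt x a ℓ t] (fun ω => h (x s ω) (a s ω)) := by
      intro h hh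
      have : Measurable (fun q : X × Fin K => h q.1 q.2) :=
        measurable_from_prod_countable_left hh
      exact this.comp (mx.prodMk ma)
    exact (((key f hfm).sub ml).pow_const 2).sub (((key fstar hfstarm).sub ml).pow_const 2)
  let S : ℕ → Ω → ℝ := fun t ω => ∑ s ∈ Finset.range t, Z s ω
  have hSm : ∀ t, Measurable[epochFilt x a ℓ t] (S t) := fun t =>
    Finset.measurable_fun_sum _ fun s hs => hZm s t (Finset.mem_range.1 hs)
  have hSb : ∀ t ω, S t ω ≤ t := by
    intro t ω
    calc S t ω ≤ ∑ s ∈ Finset.range t, (1 : ℝ) :=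
          Finset.sum_le_sum fun s _ => (abs_le.1 (hZb s ω)).2
      _ = t := by simp
  have hind : ∀ t, t ≤ n → ∫ ω, Real.exp (1 / 16 * S t ω) ∂μ ≤ Real.exp (1 / 8 * (K * M)) ^ t := by
    intro t
    induction t with
    | zero => intro _; simp [S]
    | succ t ih =>
      intro ht
      have hstep := aux_step (C := Real.exp (1 / 16 * (t : ℝ))) (hle t) (hFG t)
        (measurable_iff_comap_le.2 le_sup_right : Measurable[epochFiltX x a ℓ t] (x t)) (ham t)
        (hℓm t) hfstarm hfm (hℓ01 t) hfstar01 hf01 (hlaw t ht) (hindep t ht) (hreal t ht) (hci t ht)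
        (W := fun ω => Real.exp (1 / 16 * S t ω))
        (Real.measurable_exp.comp ((hSm t).const_mul _)) (fun ω => (Real.exp_pos _).le)
        (fun ω => Real.exp_le_exp.2 (mul_le_mul_of_nonneg_left (hSb t ω) (by norm_num))) hM
      calc _ = _ := by
            congr 1; ext ω
            simp only [S]
            rw [Finset.sum_range_succ, mul_add, Real.exp_add]
        _ ≤ _ := hstep
        _ ≤ _ := by
            rw [pow_succ']
            exact mul_le_mul_of_nonneg_left (ih (by omega)) (Real.exp_pos _).le
  set B : ℝ := 2 * K * n * M + 16 * Real.log (1 / δ) with hB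
  have hSm' : Measurable (S n) := (hSm n).mono ((hFG n).trans (hle n)) le_rfl
  have hint : Integrable (fun ω => Real.exp (1 / 16 * S n ω)) μ := by
    refine aux_int (C := Real.exp (1 / 16 * (n : ℝ))) (Real.measurable_exp.comp (hSm'.const_mul _))
      (fun ω => ?_)
    rw [abs_of_pos (Real.exp_pos _)]
    exact Real.exp_le_exp.2 (mul_le_mul_of_nonneg_left (hSb n ω) (by norm_num))
  have hbad : μ.real {ω | B ≤ S n ω} ≤ δ := by
    refine (measure_ge_le_exp_mul_mgf B (by norm_num : (0 : ℝ) ≤ 1 / 16) hint).trans ?_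
    have h1 : mgf (S n) μ (1 / 16) ≤ Real.exp (1 / 8 * (K * M)) ^ n := hind n le_rfl
    refine (mul_le_mul_of_nonneg_left h1 (Real.exp_pos _).le).trans (le_of_eq ?_)
    rw [← Real.exp_nat_mul, ← Real.exp_add]
    have : -(1 / 16) * B + n * (1 / 8 * (K * M)) = Real.log δ := by
      rw [hB, one_div δ, Real.log_inv]; ring
    rw [this, Real.exp_log hδ0]
  have hbad' : μ {ω | B ≤ S n ω} ≤ ENNReal.ofReal δ := by
    rw [← ofReal_measureReal]
    exact ENNReal.ofReal_le_ofReal hbad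
  have hcov : (1 : ENNReal) ≤ μ {ω | S n ω ≤ B} + ENNReal.ofReal δ := by
    calc (1 : ENNReal) = μ Set.univ := measure_univ.symm
      _ ≤ μ ({ω | S n ω ≤ B} ∪ {ω | B ≤ S n ω}) :=
          measure_mono fun ω _ => le_total (S n ω) B
      _ ≤ _ := (measure_union_le _ _).trans (by gcongr)
  have hset : {ω | S n ω ≤ B} ⊆ {ω | ∑ t ∈ Finset.range n,
              ((yhat t ω - ℓ t ω (a t ω)) ^ 2 - (fstar (x t ω) (a t ω) - ℓ t ω (a t ω)) ^ 2)
            ≤ (∑ t ∈ Finset.range n,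
                ((yhat t ω - ℓ t ω (a t ω)) ^ 2 - (f (x t ω) (a t ω) - ℓ t ω (a t ω)) ^ 2))
              + 2 * K * n * M
              + 16 * Real.log (1 / δ)} := by
    intro ω hω
    simp only [Set.mem_ofPred_eq, S, Z, hB, Finset.sum_sub_distrib] at hω ⊢
    linarith
  refine le_trans ?_ (measure_mono hset)
  rw [ENNReal.ofReal_sub _ hδ0.le, ENNReal.ofReal_one]
  exact tsub_le_iff_right.2 hcov
end

section
/- Let d ≥ 1, β > 0, ŷ ∈ ℝ^d, and let p = p(ŷ, β) be the SquareCB.Hilbert action distribution with parameters α and ỹ. Then the mean and second moment of p satisfy E_{a∼p}[a] = −(1−α)ỹ and E_{a∼p}[a aᵀ] = (1−α) ỹ ỹᵀ + (α/d) I, and in particular E_{a∼p}[a aᵀ] ⪰ (α/d) I in the positive semidefinite order. -/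
open Finset

/-- Expectation of `φ` under the SquareCB.Hilbert action distribution `p(ŷ, β)`
with parameters `α` and `ỹ`: probability `1 − α` on `−ỹ` and probability `α/(2d)`
on each of the `2d` points `±e_i`. -/
noncomputable def hilbertExp {d : ℕ} {E : Type*} [AddCommMonoid E] [Module ℝ E]
    (α : ℝ) (ytil : EuclideanSpace ℝ (Fin d)) (φ : EuclideanSpace ℝ (Fin d) → E) : E :=
  (1 - α) • φ (-ytil) +
    ∑ i : Fin d, ((α / (2 * d)) • φ (EuclideanSpace.single i 1) +
      (α / (2 * d)) • φ (-EuclideanSpace.single i 1))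

/-- for the SquareCB.Hilbert action distribution `p = p(ŷ, β)` with
parameters `α = min(β/‖ŷ‖, 1/2)` (`α = 1/2` if `ŷ = 0`) and `ỹ = ŷ/‖ŷ‖` (a unit
vector if `ŷ = 0`): `E_{a∼p}[a] = −(1−α)ỹ`,
`E_{a∼p}[a aᵀ] = (1−α) ỹ ỹᵀ + (α/d) I`, and `E_{a∼p}[a aᵀ] ⪰ (α/d) I` in the
positive semidefinite order. -/
theorem hilbert_dist_moments (d : ℕ) (hd : 1 ≤ d) (β : ℝ) (hβ : 0 < β)
    (yhat : EuclideanSpace ℝ (Fin d)) (α : ℝ) (ytil : EuclideanSpace ℝ (Fin d))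
    (hα : (yhat ≠ 0 → α = min (β / ‖yhat‖) (1 / 2)) ∧ (yhat = 0 → α = 1 / 2))
    (hytil : (yhat ≠ 0 → ytil = ‖yhat‖⁻¹ • yhat) ∧ (yhat = 0 → ‖ytil‖ = 1)) :
    (hilbertExp α ytil (fun a => a) = -((1 - α) • ytil)) ∧
    (hilbertExp α ytil (fun a => Matrix.vecMulVec (fun i => a i) (fun i => a i))
      = (1 - α) • Matrix.vecMulVec (fun i => ytil i) (fun i => ytil i)
        + (α / d) • (1 : Matrix (Fin d) (Fin d) ℝ)) ∧
    (hilbertExp α ytil (fun a => Matrix.vecMulVec (fun i => a i) (fun i => a i))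
      - (α / d) • (1 : Matrix (Fin d) (Fin d) ℝ)).PosSemidef := by
  have hd0 : (d : ℝ) ≠ 0 := by
    have : d ≠ 0 := by omega
    exact_mod_cast this
  have hα1 : 0 ≤ 1 - α := by
    by_cases h : yhat = 0
    · rw [hα.2 h]; norm_num
    · rw [hα.1 h]
      have := min_le_right (β / ‖yhat‖) (1 / 2 : ℝ)
      linarith
  have h2 : hilbertExp α ytil (fun a => Matrix.vecMulVec (fun i => a i) (fun i => a i))
      = (1 - α) • Matrix.vecMulVec (fun i => ytil i) (fun i => ytil i)
        + (α / d) • (1 : Matrix (Fin d) (Fin d) ℝ) := by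
    unfold hilbertExp
    ext j k
    have hs : ∀ i : Fin d,
        ((α / (2 * d)) • Matrix.vecMulVec (fun l => (EuclideanSpace.single i (1 : ℝ)) l)
            (fun l => (EuclideanSpace.single i (1 : ℝ)) l) +
          (α / (2 * d)) • Matrix.vecMulVec (fun l => (-EuclideanSpace.single i (1 : ℝ)) l)
            (fun l => (-EuclideanSpace.single i (1 : ℝ)) l)) j k
        = if j = i then (if k = i then α / d else 0) else 0 := by
      intro i
      simp only [Matrix.add_apply, Matrix.smul_apply, Matrix.vecMulVec_apply, smul_eq_mul,
        PiLp.neg_apply, PiLp.single_apply]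
      split_ifs <;> field_simp <;> ring
    rw [Matrix.add_apply, Matrix.sum_apply, Finset.sum_congr rfl (fun i _ => hs i)]
    simp [Matrix.vecMulVec_apply, Matrix.one_apply, eq_comm]
  refine ⟨?_, h2, ?_⟩
  · unfold hilbertExp
    simp
  · rw [h2, add_sub_cancel_right]
    have := Matrix.posSemidef_vecMulVec_self_star (fun i => ytil i)
    simp only [star_trivial] at this
    exact this.smul hα1
end

section
/- Let d ≥ 1, β > 0, ŷ ∈ ℝ^d with ‖ŷ‖₂ ≤ 2β (so the SquareCB.Hilbert distribution p = p(ŷ, β) has α = 1/2), let f* ∈ B_d (the closed unit ball), and let Σ := E_{a∼p}[a aᵀ]. Then sup_{a*∈B_d} E_{a∼p}[⟨f*, a⟩ − ⟨f*, a*⟩] ≤ 9β + (4d/β) ⟨ŷ − f*, Σ(ŷ − f*)⟩. -/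
open Finset Matrix RealInnerProductSpace

/-- The second-moment matrix `Σ = E_{a∼p}[a aᵀ]` of the SquareCB.Hilbert
distribution. -/
noncomputable def hilbertSecondMoment {d : ℕ} (α : ℝ) (ytil : EuclideanSpace ℝ (Fin d)) :
    Matrix (Fin d) (Fin d) ℝ :=
  hilbertExp α ytil (fun a => Matrix.vecMulVec (fun i => a i) (fun i => a i))

lemma quad_aux {d : ℕ} (w v : Fin d → ℝ) :
    v ⬝ᵥ (Matrix.vecMulVec w w).mulVec v = (w ⬝ᵥ v) ^ 2 := by
  rw [Matrix.vecMulVec_mulVec, dotProduct_comm v]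
  simp [sq]

lemma quad_form {d : ℕ} (α : ℝ) (y : EuclideanSpace ℝ (Fin d)) (v : Fin d → ℝ) :
    v ⬝ᵥ (hilbertSecondMoment α y).mulVec v
      = (1 - α) * ((fun i => y i) ⬝ᵥ v) ^ 2 + α / d * ∑ i, v i ^ 2 := by
  unfold hilbertSecondMoment hilbertExp
  rw [Matrix.add_mulVec, dotProduct_add, Matrix.sum_mulVec, dotProduct_sum, Finset.mul_sum]
  congr 1
  · rw [Matrix.smul_mulVec, dotProduct_smul, quad_aux]
    have : (fun i => (-y) i) ⬝ᵥ v = -((fun i => y i) ⬝ᵥ v) := by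
      simp [dotProduct]
    rw [this, smul_eq_mul, neg_sq]
  · refine Finset.sum_congr rfl fun i _ => ?_
    rw [Matrix.add_mulVec, dotProduct_add, Matrix.smul_mulVec, dotProduct_smul, quad_aux,
      Matrix.smul_mulVec, dotProduct_smul, quad_aux]
    have h1 : (fun j => (EuclideanSpace.single i (1:ℝ)) j) ⬝ᵥ v = v i := by
      simp [dotProduct, Pi.single_apply]
    have h2 : (fun j => (-EuclideanSpace.single i (1:ℝ)) j) ⬝ᵥ v = - v i := by
      simp [dotProduct, Pi.single_apply]
    rw [h1, h2, smul_eq_mul, smul_eq_mul]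
    ring

lemma lin_form {d : ℕ} (hd : 1 ≤ d) (α : ℝ) (y f a' : EuclideanSpace ℝ (Fin d)) :
    hilbertExp α y (fun a => ⟪f, a⟫ - ⟪f, a'⟫) = - (1 - α) * ⟪f, y⟫ - ⟪f, a'⟫ := by
  have hd' : (d : ℝ) ≠ 0 := by positivity
  unfold hilbertExp
  have : ∀ i : Fin d, ((α / (2 * d)) • (⟪f, EuclideanSpace.single i 1⟫ - ⟪f, a'⟫) +
      (α / (2 * d)) • (⟪f, -EuclideanSpace.single i 1⟫ - ⟪f, a'⟫)) = -(α / d * ⟪f, a'⟫) := by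
    intro i
    rw [inner_neg_right, smul_eq_mul, smul_eq_mul]
    ring
  simp only [this]
  rw [Finset.sum_const, inner_neg_right]
  simp only [Finset.card_univ, Fintype.card_fin, smul_eq_mul, nsmul_eq_mul]
  field_simp
  ring

/-- degenerate case `α = 1/2` of SquareCB.Hilbert: if `‖ŷ‖ ≤ 2β`
(so `α = 1/2`), then for every `f*` in the closed unit ball,
`sup_{a*∈B_d} E_{a∼p}[⟨f*,a⟩ − ⟨f*,a*⟩] ≤ 9β + (4d/β)⟨ŷ − f*, Σ(ŷ − f*)⟩`. -/
theorem hilbert_per_step_case_small (d : ℕ) (hd : 1 ≤ d) (β : ℝ) (hβ : 0 < β)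
    (yhat : EuclideanSpace ℝ (Fin d)) (hy : ‖yhat‖ ≤ 2 * β)
    (α : ℝ) (ytil : EuclideanSpace ℝ (Fin d))
    (hα : α = 1 / 2)
    (hytil : (yhat ≠ 0 → ytil = ‖yhat‖⁻¹ • yhat) ∧ (yhat = 0 → ‖ytil‖ = 1))
    (fstar : EuclideanSpace ℝ (Fin d)) (hf : ‖fstar‖ ≤ 1) :
    (⨆ astar : (Metric.closedBall (0 : EuclideanSpace ℝ (Fin d)) 1),
        hilbertExp α ytil (fun a => ⟪fstar, a⟫ - ⟪fstar, (astar : EuclideanSpace ℝ (Fin d))⟫))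
      ≤ 9 * β + (4 * d / β) *
          ((fun i => yhat i - fstar i) ⬝ᵥ
            (hilbertSecondMoment α ytil).mulVec (fun i => yhat i - fstar i)) := by
  have hn : ‖ytil‖ = 1 := by
    by_cases h : yhat = 0
    · exact hytil.2 h
    · rw [hytil.1 h, norm_smul, norm_inv, norm_norm, inv_mul_cancel₀ (norm_ne_zero_iff.2 h)]
  have hd' : (0 : ℝ) < d := by exact_mod_cast hd
  have : Nonempty (Metric.closedBall (0 : EuclideanSpace ℝ (Fin d)) 1) := ⟨⟨0, by simp⟩⟩
  refine ciSup_le fun a' => ?_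
  have ha : ‖(a' : EuclideanSpace ℝ (Fin d))‖ ≤ 1 := mem_closedBall_zero_iff.1 a'.2
  rw [lin_form hd, quad_form, hα]
  have hs : ∑ i, (yhat i - fstar i) ^ 2 = ‖yhat - fstar‖ ^ 2 := by
    rw [EuclideanSpace.norm_sq_eq]
    simp
  rw [hs]
  set x := ‖yhat - fstar‖
  set t := (fun i => ytil i) ⬝ᵥ (fun i => yhat i - fstar i)
  have h1 : -(‖fstar‖) ≤ ⟪fstar, ytil⟫ := by
    have := (abs_le.1 (abs_real_inner_le_norm fstar ytil)).1
    rwa [hn, mul_one] at this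
  have h2 : -(‖fstar‖) ≤ ⟪fstar, (a' : EuclideanSpace ℝ (Fin d))⟫ := by
    have h := (abs_le.1 (abs_real_inner_le_norm fstar (a' : EuclideanSpace ℝ (Fin d)))).1
    have := mul_le_of_le_one_right (norm_nonneg fstar) ha
    linarith
  have h3 : ‖fstar‖ ≤ ‖yhat‖ + x := by
    have := norm_sub_norm_le fstar yhat
    rw [norm_sub_rev] at this
    linarith
  have h4 : 4 * d / β * ((1 - 1 / 2) * t ^ 2 + 1 / 2 / d * x ^ 2)
      = 2 * d / β * t ^ 2 + 2 * (x ^ 2 / β) := by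
    field_simp
    ring
  have h5 : 0 ≤ 2 * d / β * t ^ 2 := by positivity
  have h6 : 2 * x - β ≤ x ^ 2 / β := by
    rw [le_div_iff₀ hβ]
    nlinarith [sq_nonneg (x - β)]
  have h7 : 0 ≤ x := norm_nonneg _
  rw [h4]
  linarith
end

section
/- Let d ≥ 1, β > 0, ŷ ∈ ℝ^d with ‖ŷ‖₂ ≥ 2β (so the SquareCB.Hilbert distribution p = p(ŷ, β) has α = β/‖ŷ‖₂ ≤ 1/2), let f* ∈ B_d (the closed unit ball), and let Σ := E_{a∼p}[a aᵀ]. Then sup_{a*∈B_d} E_{a∼p}[⟨f*, a⟩ − ⟨f*, a*⟩] ≤ (3/2)β + (d/(2β)) ⟨ŷ − f*, Σ(ŷ − f*)⟩. -/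
open Finset Matrix RealInnerProductSpace

theorem hilbertExp_lin {d : ℕ} (hd : 1 ≤ d) (α : ℝ) (y f : EuclideanSpace ℝ (Fin d)) (c : ℝ) :
    hilbertExp α y (fun a => ⟪f, a⟫ - c) = -(1 - α) * ⟪f, y⟫ - c := by
  have hd' : (d : ℝ) ≠ 0 := by positivity
  unfold hilbertExp
  have h : ∀ i : Fin d, ((α / (2 * d)) • (⟪f, EuclideanSpace.single i (1:ℝ)⟫ - c) +
      (α / (2 * d)) • (⟪f, -EuclideanSpace.single i (1:ℝ)⟫ - c)) = -(α / d) * c := by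
    intro i
    rw [inner_neg_right]
    simp only [smul_eq_mul]
    field_simp
    ring
  rw [Finset.sum_congr rfl (fun i _ => h i)]
  simp only [inner_neg_right, smul_eq_mul, Finset.sum_const, Finset.card_univ, Fintype.card_fin,
    nsmul_eq_mul]
  field_simp
  ring

theorem vecMulVec_quad {d : ℕ} (a v : EuclideanSpace ℝ (Fin d)) :
    (fun i => v i) ⬝ᵥ (Matrix.vecMulVec (fun i => a i) (fun i => a i)).mulVec (fun i => v i)
      = ⟪a, v⟫ ^ 2 := by
  rw [Matrix.vecMulVec_mulVec]
  simp only [dotProduct, PiLp.inner_apply, RCLike.inner_apply, conj_trivial, sq, Finset.sum_mul,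
    Pi.smul_apply, MulOpposite.smul_eq_mul_unop, MulOpposite.unop_op, Finset.mul_sum]
  refine Finset.sum_congr rfl fun i _ => Finset.sum_congr rfl fun j _ => by ring

theorem hilbert_quad {d : ℕ} (hd : 1 ≤ d) (α : ℝ) (y v : EuclideanSpace ℝ (Fin d)) :
    (fun i => v i) ⬝ᵥ (hilbertSecondMoment α y).mulVec (fun i => v i)
      = (1 - α) * ⟪y, v⟫ ^ 2 + α / d * ‖v‖ ^ 2 := by
  have hd' : (d : ℝ) ≠ 0 := by positivity
  unfold hilbertSecondMoment hilbertExp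
  rw [Matrix.add_mulVec, Matrix.sum_mulVec, dotProduct_add, dotProduct_sum]
  simp only [Matrix.add_mulVec, dotProduct_add, Matrix.smul_mulVec, dotProduct_smul,
    vecMulVec_quad, smul_eq_mul, inner_neg_left, neg_sq]
  rw [EuclideanSpace.real_norm_sq_eq, Finset.mul_sum]
  congr 1
  refine Finset.sum_congr rfl fun i _ => ?_
  rw [EuclideanSpace.inner_single_left]
  simp
  field_simp
  ring

/-- main case `α = β/‖ŷ‖ ≤ 1/2` of SquareCB.Hilbert: if
`‖ŷ‖ ≥ 2β` (so `α = β/‖ŷ‖ ≤ 1/2`), then for every `f*` in the closed unit ball,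
`sup_{a*∈B_d} E_{a∼p}[⟨f*,a⟩ − ⟨f*,a*⟩] ≤ (3/2)β + (d/(2β))⟨ŷ − f*, Σ(ŷ − f*)⟩`. -/
theorem hilbert_per_step_case_large (d : ℕ) (hd : 1 ≤ d) (β : ℝ) (hβ : 0 < β)
    (yhat : EuclideanSpace ℝ (Fin d)) (hy : 2 * β ≤ ‖yhat‖)
    (α : ℝ) (ytil : EuclideanSpace ℝ (Fin d))
    (hα : α = β / ‖yhat‖)
    (hytil : ytil = ‖yhat‖⁻¹ • yhat)
    (fstar : EuclideanSpace ℝ (Fin d)) (hf : ‖fstar‖ ≤ 1) :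
    (⨆ astar : (Metric.closedBall (0 : EuclideanSpace ℝ (Fin d)) 1),
        hilbertExp α ytil (fun a => ⟪fstar, a⟫ - ⟪fstar, (astar : EuclideanSpace ℝ (Fin d))⟫))
      ≤ (3 / 2) * β + (d / (2 * β)) *
          ((fun i => yhat i - fstar i) ⬝ᵥ
            (hilbertSecondMoment α ytil).mulVec (fun i => yhat i - fstar i)) := by
  have hn : 0 < ‖yhat‖ := by linarith
  have : Nonempty (Metric.closedBall (0 : EuclideanSpace ℝ (Fin d)) 1) := ⟨⟨0, by simp⟩⟩
  have hD : (1 : ℝ) ≤ d := by exact_mod_cast hd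
  have hq := hilbert_quad hd α ytil (yhat - fstar)
  simp only [PiLp.sub_apply] at hq
  refine ciSup_le fun astar => ?_
  rw [hilbertExp_lin hd, hq]
  have ha : ‖(astar : EuclideanSpace ℝ (Fin d))‖ ≤ 1 := mem_closedBall_zero_iff.mp astar.2
  have hcs : -⟪fstar, (astar : EuclideanSpace ℝ (Fin d))⟫ ≤ ‖fstar‖ := by
    have h1 := abs_real_inner_le_norm fstar (astar : EuclideanSpace ℝ (Fin d))
    have h2 := neg_abs_le ⟪fstar, (astar : EuclideanSpace ℝ (Fin d))⟫
    have h3 := mul_le_mul_of_nonneg_left ha (norm_nonneg fstar)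
    linarith
  have hyf : ⟪yhat, fstar⟫ = ‖yhat‖ * ⟪fstar, ytil⟫ := by
    rw [hytil, inner_smul_right, real_inner_comm]
    field_simp
  have hyv : ⟪ytil, yhat - fstar⟫ = ‖yhat‖ - ⟪fstar, ytil⟫ := by
    rw [inner_sub_right, real_inner_comm ytil fstar]
    congr 1
    rw [hytil, inner_smul_left, real_inner_self_eq_norm_sq]
    simp
    field_simp
  rw [hyv, norm_sub_sq_real, hyf]
  generalize ⟪fstar, ytil⟫ = t at *
  generalize ‖yhat‖ = n at *
  generalize ‖fstar‖ = s at *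
  generalize ⟪fstar, (astar : EuclideanSpace ℝ (Fin d))⟫ = c at *
  have hα2 : α ≤ 1 / 2 := by
    rw [hα, div_le_iff₀ hn]; linarith
  have hα0 : 0 < α := by rw [hα]; positivity
  have e1 : (d : ℝ) / (2 * β) * ((1 - α) * (n - t) ^ 2 + α / d * (n ^ 2 - 2 * (n * t) + s ^ 2))
      = d * ((1 - α) / (2 * β) * (n - t) ^ 2) + ((n - s) ^ 2 / (2 * n) + s - t) := by
    have : (d : ℝ) ≠ 0 := by positivity
    have h : α / (2 * β) = 1 / (2 * n) := by rw [hα]; field_simp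
    have h2 : (n - s) ^ 2 / (2 * n) + s - t
        = α / (2 * β) * (n ^ 2 - 2 * (n * t) + s ^ 2) := by
      rw [h]; field_simp; ring
    rw [h2]; field_simp
  have e2 : (n - t) ^ 2 / (4 * β) ≤ (1 - α) / (2 * β) * (n - t) ^ 2 := by
    rw [div_mul_eq_mul_div, div_le_div_iff₀ (by positivity) (by positivity)]
    have : 0 ≤ (1 - 2 * α) * (β * (n - t) ^ 2) := 
      mul_nonneg (by linarith) (by positivity)
    nlinarith
  have e3 : (1 - α) / (2 * β) * (n - t) ^ 2 ≤ d * ((1 - α) / (2 * β) * (n - t) ^ 2) := by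
    refine le_mul_of_one_le_left ?_ hD
    exact mul_nonneg (div_nonneg (by linarith) (by positivity)) (sq_nonneg _)
  have e4 : 0 ≤ (n - s) ^ 2 / (2 * n) := by positivity
  have e5 : α * t = β + α * (t - n) := by rw [hα]; field_simp; ring
  have e6 : α * (t - n) ≤ β / 2 + (n - t) ^ 2 / (4 * β) := by
    have k1 : α * (t - n) ≤ |t - n| / 2 := by
      have := mul_le_mul_of_nonneg_left (le_abs_self (t - n)) hα0.le
      have := mul_le_mul_of_nonneg_right hα2 (abs_nonneg (t - n))
      linarith
    have k2 : β / 2 + (n - t) ^ 2 / (4 * β) - |t - n| / 2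
        = ((|t - n| - β) ^ 2 + β ^ 2) / (4 * β) := by
      have : (n - t) ^ 2 = |t - n| ^ 2 := by rw [sq_abs]; ring
      rw [this]; field_simp; ring
    have k3 : 0 ≤ ((|t - n| - β) ^ 2 + β ^ 2) / (4 * β) := by positivity
    linarith
  rw [e1]
  nlinarith
end

section
/- Let d ≥ 1, β > 0, ŷ ∈ ℝ^d with ‖ŷ‖₂ ≥ 2β, and set α = β/‖ŷ‖₂ ≤ 1/2, ỹ = ŷ/‖ŷ‖₂, Σ = (1−α) ỹ ỹᵀ + (α/d) I, and μ = −(1−α)ỹ. Let f* ∈ ℝ^d be a nonzero vector with ‖f*‖₂ ≤ 1, set f̃ = f*/‖f*‖₂ and a* = −f̃. Then ⟨μ − a*, Σ^{−1}(μ − a*)⟩ ≤ (2d/β)(‖ŷ‖₂ − ⟨ŷ, f̃⟩) + 2dα. -/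
open Finset Matrix RealInnerProductSpace

theorem aux_inv {d : ℕ} (y v : Fin d → ℝ) (hy : y ⬝ᵥ y = 1) (b c : ℝ) (hc : 0 < c) (hb : 0 ≤ b) :
    v ⬝ᵥ ((b • Matrix.vecMulVec y y + c • (1 : Matrix (Fin d) (Fin d) ℝ))⁻¹).mulVec v
      = c⁻¹ * (v ⬝ᵥ v - b / (b + c) * (y ⬝ᵥ v) ^ 2) := by
  have hbc : b + c ≠ 0 := by positivity
  have h1 : (b • Matrix.vecMulVec y y + c • (1 : Matrix (Fin d) (Fin d) ℝ))⁻¹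
      = c⁻¹ • (1 : Matrix (Fin d) (Fin d) ℝ) - (c⁻¹ * (b / (b + c))) • Matrix.vecMulVec y y := by
    apply Matrix.inv_eq_right_inv
    have h2 : Matrix.vecMulVec y y * Matrix.vecMulVec y y = Matrix.vecMulVec y y := by
      rw [Matrix.vecMulVec_mul_vecMulVec, hy, one_smul]
    simp only [add_mul, mul_sub, smul_mul_assoc, mul_smul_comm, h2, mul_one, one_mul, smul_smul]
    have h3 : (1 : Matrix (Fin d) (Fin d) ℝ) = (c * c⁻¹) • (1 : Matrix (Fin d) (Fin d) ℝ) := by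
      rw [mul_inv_cancel₀ hc.ne', one_smul]
    have h4 : b * c⁻¹ - c⁻¹ * (b / (b + c)) * b - c⁻¹ * (b / (b + c)) * c = 0 := by
      field_simp
      ring
    ext i j
    simp only [Matrix.add_apply, Matrix.sub_apply, Matrix.smul_apply, smul_eq_mul]
    have h5 := congrArg (fun M => M i j) h3
    simp only [Matrix.smul_apply, smul_eq_mul] at h5
    linear_combination (Matrix.vecMulVec y y i j) * h4 - h5
  rw [h1, Matrix.sub_mulVec, Matrix.smul_mulVec, Matrix.smul_mulVec, Matrix.one_mulVec,
    Matrix.vecMulVec_mulVec, dotProduct_sub, dotProduct_smul, dotProduct_smul]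
  simp only [op_smul_eq_smul, dotProduct_smul, smul_eq_mul, dotProduct_comm v y]
  ring

/-- key matrix computation for SquareCB.Hilbert: with
`α = β/‖ŷ‖ ≤ 1/2`, `ỹ = ŷ/‖ŷ‖`, `Σ = (1−α) ỹỹᵀ + (α/d) I`, `μ = −(1−α)ỹ`,
`f̃ = f*/‖f*‖` and `a* = −f̃`, one has
`⟨μ − a*, Σ⁻¹(μ − a*)⟩ ≤ (2d/β)(‖ŷ‖ − ⟨ŷ, f̃⟩) + 2dα`. -/
theorem hilbert_inverse_quadratic_bound (d : ℕ) (hd : 1 ≤ d) (β : ℝ) (hβ : 0 < β)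
    (yhat : EuclideanSpace ℝ (Fin d)) (hy : 2 * β ≤ ‖yhat‖)
    (α : ℝ) (hα : α = β / ‖yhat‖)
    (ytil : EuclideanSpace ℝ (Fin d)) (hytil : ytil = ‖yhat‖⁻¹ • yhat)
    (Sig : Matrix (Fin d) (Fin d) ℝ)
    (hSig : Sig = (1 - α) • Matrix.vecMulVec (fun i => ytil i) (fun i => ytil i)
      + (α / d) • (1 : Matrix (Fin d) (Fin d) ℝ))
    (μv : EuclideanSpace ℝ (Fin d)) (hμ : μv = -((1 - α) • ytil))
    (fstar : EuclideanSpace ℝ (Fin d)) (hf0 : fstar ≠ 0) (hf : ‖fstar‖ ≤ 1)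
    (ftil : EuclideanSpace ℝ (Fin d)) (hftil : ftil = ‖fstar‖⁻¹ • fstar)
    (astar : EuclideanSpace ℝ (Fin d)) (hastar : astar = -ftil) :
    ((fun i => μv i - astar i) ⬝ᵥ (Sig⁻¹).mulVec (fun i => μv i - astar i))
      ≤ (2 * d / β) * (‖yhat‖ - ⟪yhat, ftil⟫) + 2 * d * α := by
  have hn : 0 < ‖yhat‖ := by linarith
  have hfn : 0 < ‖fstar‖ := norm_pos_iff.mpr hf0
  have hα0 : 0 < α := by rw [hα]; positivity
  have hα1 : α ≤ 1 / 2 := by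
    rw [hα, div_le_div_iff₀ hn (by norm_num)]
    linarith
  have hd' : (1 : ℝ) ≤ d := by exact_mod_cast hd
  have hyn : ‖ytil‖ = 1 := by
    rw [hytil, norm_smul, norm_inv, norm_norm, inv_mul_cancel₀ hn.ne']
  have hftn : ‖ftil‖ = 1 := by
    rw [hftil, norm_smul, norm_inv, norm_norm, inv_mul_cancel₀ hfn.ne']
  have dot : ∀ u w : EuclideanSpace ℝ (Fin d), (fun i => u i) ⬝ᵥ (fun i => w i) = ⟪u, w⟫ := by
    intro u w
    simp [PiLp.inner_apply, dotProduct, mul_comm]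
  have hv : (fun i => μv i - astar i) = (fun i => (ftil - (1 - α) • ytil) i) := by
    funext i
    simp [hμ, hastar]
    ring
  have hyy : (fun i => ytil i) ⬝ᵥ (fun i => ytil i) = 1 := by
    rw [dot, real_inner_self_eq_norm_sq, hyn]; norm_num
  have hin : ⟪yhat, ftil⟫ = ‖yhat‖ * ⟪ytil, ftil⟫ := by
    rw [hytil, real_inner_smul_left]
    field_simp
  have hnb : ‖yhat‖ = β / α := by
    rw [hα]; field_simp
  have ht := real_inner_le_norm ytil ftil
  rw [hyn, hftn] at ht
  rw [hv, hSig, aux_inv _ _ hyy _ _ (by positivity) (by linarith), dot, dot, hin]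
  have e1 : ⟪ftil - (1 - α) • ytil, ftil - (1 - α) • ytil⟫
      = 1 - 2 * (1 - α) * ⟪ytil, ftil⟫ + (1 - α) ^ 2 := by
    rw [real_inner_self_eq_norm_sq, norm_sub_sq_real, real_inner_smul_right, norm_smul, hyn, hftn,
      real_inner_comm, mul_one, Real.norm_eq_abs, sq_abs]
    ring
  have e2 : ⟪ytil, ftil - (1 - α) • ytil⟫ = ⟪ytil, ftil⟫ - (1 - α) := by
    rw [inner_sub_right, real_inner_smul_right, real_inner_self_eq_norm_sq, hyn]
    ring
  rw [e1, e2, hnb]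
  generalize ⟪ytil, ftil⟫ = t at *
  have hc : 0 < α / d := by positivity
  have hB : 1 / 2 ≤ 1 - α + α / d := by linarith
  have hB0 : 0 < 1 - α + α / d := by linarith
  have k1 : (α / d)⁻¹ * (1 - 2 * (1 - α) * t + (1 - α) ^ 2
        - (1 - α) / (1 - α + α / d) * (t - (1 - α)) ^ 2)
      = (t - (1 - α)) ^ 2 / (1 - α + α / d) + d / α * (1 - t ^ 2) := by
    have : (d : ℝ) / α = (α / d)⁻¹ := by rw [inv_div]
    rw [this]
    generalize α / (d : ℝ) = c at *
    field_simp
    ring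
  have k2 : (2 * d / β) * (β / α - β / α * t) = d / α * (2 * (1 - t)) := by
    field_simp
  rw [k1, k2]
  have k3 : (t - (1 - α)) ^ 2 / (1 - α + α / d) ≤ 2 * (t - (1 - α)) ^ 2 := by
    rw [div_le_iff₀ hB0]
    nlinarith [sq_nonneg (t - (1 - α))]
  have k4 : 2 ≤ d / α := by
    rw [le_div_iff₀ hα0]; linarith
  have k5 : 2 * (1 - t) ^ 2 ≤ d / α * (1 - t) ^ 2 := by gcongr
  have k6 : 2 * α ^ 2 ≤ 2 * d * α := by nlinarith
  have k7 : 0 ≤ (1 - t) * α := mul_nonneg (by linarith) hα0.le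
  nlinarith
end

section
/- Let σ : [−1,1] → [0,1] be a nondecreasing 1-Lipschitz link function and θ* ∈ ℝ^d with ‖θ*‖₂ ≤ 1. Consider T rounds of online prediction on a probability space with filtration (G_t), where G_{t−1} = σ(x_1, y_1, …, x_{t−1}, y_{t−1}, x_t): the feature vectors x_t ∈ ℝ^d with ‖x_t‖₂ ≤ 1 are chosen adaptively (G_{t−1}-measurable), and the outcomes y_t ∈ [0,1] satisfy E[y_t | G_{t−1}] = σ(⟨θ*, x_t⟩). Run projected GLMtron with learning rate η = 1/√T: θ_1 = 0 and θ_{t+1} = Proj_{B_d}(θ_t − η g_t) where g_t := 2(σ(⟨θ_t, x_t⟩) − y_t) x_t and Proj_{B_d} is Euclidean projection onto the unit ball. Then there is a universal constant C > 0 such that for every δ ∈ (0,1), with probability at least 1 − δ, Σ_{t=1}^T (σ(⟨θ_t, x_t⟩) − σ(⟨θ*, x_t⟩))² ≤ C(√T + √(T log(1/δ))). -/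
open MeasureTheory ProbabilityTheory Finset RealInnerProductSpace

/-- Euclidean projection onto the closed unit ball `B_d ⊂ ℝ^d`. -/
noncomputable def projBall {d : ℕ} (v : EuclideanSpace ℝ (Fin d)) :
    EuclideanSpace ℝ (Fin d) :=
  if ‖v‖ ≤ 1 then v else ‖v‖⁻¹ • v

/-- The filtration of the online prediction process:
`G_{t-1} = σ(x_1, y_1, …, x_{t-1}, y_{t-1}, x_t)` (rounds indexed from `0`). -/
def glmFilt {Ω : Type} {d : ℕ} (x : ℕ → Ω → EuclideanSpace ℝ (Fin d))
    (y : ℕ → Ω → ℝ) (t : ℕ) : MeasurableSpace Ω :=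
  (⨆ s ∈ Set.Iio t,
      (MeasurableSpace.comap (x s) inferInstance ⊔
        MeasurableSpace.comap (y s) inferInstance)) ⊔
    MeasurableSpace.comap (x t) inferInstance


lemma projBall_norm_le {d : ℕ} (v : EuclideanSpace ℝ (Fin d)) : ‖projBall v‖ ≤ 1 := by
  unfold projBall
  split_ifs with h
  · exact h
  · have hv : 0 < ‖v‖ := by linarith
    rw [norm_smul, norm_inv, norm_norm, inv_mul_cancel₀ hv.ne']

lemma projBall_contract {d : ℕ} (v w : EuclideanSpace ℝ (Fin d)) (hw : ‖w‖ ≤ 1) :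
    ‖projBall v - w‖ ^ 2 ≤ ‖v - w‖ ^ 2 := by
  unfold projBall
  split_ifs with h
  · exact le_rfl
  · have hv : 1 < ‖v‖ := by linarith
    have hv0 : 0 < ‖v‖ := by linarith
    rw [norm_sub_sq_real, norm_sub_sq_real, norm_smul, norm_inv, norm_norm,
      inv_mul_cancel₀ hv0.ne', real_inner_smul_left]
    have hin : ⟪v, w⟫ ≤ ‖v‖ := (real_inner_le_norm v w).trans (by nlinarith)
    have hi1 : ‖v‖⁻¹ ≤ 1 := inv_le_one_of_one_le₀ hv.le
    have hi2 : ‖v‖⁻¹ * ‖v‖ = 1 := inv_mul_cancel₀ hv0.ne'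
    have h3 : (1 - ‖v‖⁻¹) * ⟪v, w⟫ ≤ (1 - ‖v‖⁻¹) * ‖v‖ :=
      mul_le_mul_of_nonneg_left hin (by linarith)
    nlinarith [sq_nonneg (‖v‖ - 1)]

lemma projBall_measurable {d : ℕ} :
    Measurable (projBall : EuclideanSpace ℝ (Fin d) → EuclideanSpace ℝ (Fin d)) := by
  unfold projBall
  exact Measurable.ite (measurableSet_le measurable_norm measurable_const) measurable_id
    (measurable_norm.inv.smul measurable_id)

lemma step_measurable {Ω : Type} [MeasurableSpace Ω] {d : ℕ} (σl : ℝ → ℝ) (hσ : Measurable σl)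
    (η : ℝ) (θ x : Ω → EuclideanSpace ℝ (Fin d)) (y : Ω → ℝ)
    (hθ : Measurable θ) (hx : Measurable x) (hy : Measurable y) :
    Measurable fun ω => projBall (θ ω - (η * (2 * (σl ⟪θ ω, x ω⟫ - y ω))) • x ω) := by
  have h1 : Measurable fun ω => σl ⟪θ ω, x ω⟫ := hσ.comp (hθ.inner hx)
  exact projBall_measurable.comp
    (hθ.sub (((h1.sub hy).const_mul 2 |>.const_mul η).smul hx))

lemma exp_le_aux (l u : ℝ) (hu : |u| ≤ 2) :
    Real.exp (l * u) ≤ Real.cosh (2 * l) + u * (Real.sinh (2 * l) / 2) := by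
  obtain ⟨h1, h2⟩ := abs_le.1 hu
  have := convexOn_exp.2 (Set.mem_univ (2 * l)) (Set.mem_univ (-(2 * l)))
    (show 0 ≤ (2 + u) / 4 by linarith) (show 0 ≤ (2 - u) / 4 by linarith) (by ring)
  simp only [smul_eq_mul] at this
  rw [Real.cosh_eq, Real.sinh_eq]
  calc _ = Real.exp ((2 + u) / 4 * (2 * l) + (2 - u) / 4 * -(2 * l)) := by ring_nf
    _ ≤ _ := this
    _ = _ := by ring

lemma azuma {Ω : Type} {m0 : MeasurableSpace Ω} (μ : Measure Ω) [IsProbabilityMeasure μ]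
    (T : ℕ) (G : ℕ → MeasurableSpace Ω) (hG : ∀ t, G t ≤ m0) (ξ : ℕ → Ω → ℝ)
    (hm : ∀ t, Measurable (ξ t))
    (hS : ∀ t, Measurable[G t] fun ω => ∑ s ∈ range t, ξ s ω)
    (hb : ∀ t ω, |ξ t ω| ≤ 2)
    (h0 : ∀ t < T, ∀ W : Ω → ℝ, Measurable[G t] W → (∃ K, ∀ ω, |W ω| ≤ K) →
      ∫ ω, W ω * ξ t ω ∂μ = 0) (l : ℝ) (t : ℕ) (ht : t ≤ T) :
    Integrable (fun ω => Real.exp (l * ∑ s ∈ range t, ξ s ω)) μ ∧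
    ∫ ω, Real.exp (l * ∑ s ∈ range t, ξ s ω) ∂μ ≤ Real.exp (2 * l ^ 2 * t) := by
  have hSb : ∀ t ω, |∑ s ∈ range t, ξ s ω| ≤ t * 2 := fun t ω =>
    (abs_sum_le_sum_abs _ _).trans ((sum_le_sum fun i _ => hb i ω).trans (by simp))
  have hWb : ∀ t ω, |Real.exp (l * ∑ s ∈ range t, ξ s ω)| ≤ Real.exp (|l| * (t * 2)) := by
    intro t ω
    rw [Real.abs_exp]
    apply Real.exp_le_exp.2
    refine (le_abs_self _).trans ?_
    rw [abs_mul]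
    exact mul_le_mul_of_nonneg_left (hSb t ω) (abs_nonneg _)
  have hWm : ∀ t, Measurable[G t] fun ω => Real.exp (l * ∑ s ∈ range t, ξ s ω) := fun t =>
    Real.measurable_exp.comp (measurable_const.mul (hS t))
  have hWi : ∀ t, Integrable (fun ω => Real.exp (l * ∑ s ∈ range t, ξ s ω)) μ := fun t =>
    Integrable.of_bound ((hWm t).mono (hG t) le_rfl).aestronglyMeasurable _
      (Filter.Eventually.of_forall (hWb t))
  refine ⟨hWi t, ?_⟩
  induction t with
  | zero => simp
  | succ t ih =>
    have ih := ih (by omega)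
    have hi2 : Integrable (fun ω => Real.exp (l * ∑ s ∈ range t, ξ s ω) * ξ t ω) μ :=
      (hWi t).mul_bdd (c := 2) (hm t).aestronglyMeasurable (Filter.Eventually.of_forall (hb t))
    calc ∫ ω, Real.exp (l * ∑ s ∈ range (t + 1), ξ s ω) ∂μ
        ≤ ∫ ω, (Real.exp (l * ∑ s ∈ range t, ξ s ω) * Real.cosh (2 * l) +
            (Real.exp (l * ∑ s ∈ range t, ξ s ω) * ξ t ω) * (Real.sinh (2 * l) / 2)) ∂μ := by
          refine integral_mono (hWi _) (((hWi t).mul_const _).add (hi2.mul_const _)) ?_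
          intro ω
          simp only
          rw [sum_range_succ, mul_add, Real.exp_add]
          have := mul_le_mul_of_nonneg_left (exp_le_aux l (ξ t ω) (hb t ω))
            (Real.exp_pos (l * ∑ s ∈ range t, ξ s ω)).le
          linarith
      _ = (∫ ω, Real.exp (l * ∑ s ∈ range t, ξ s ω) ∂μ) * Real.cosh (2 * l) := by
          rw [integral_add ((hWi t).mul_const _) (hi2.mul_const _), integral_mul_const,
            integral_mul_const, h0 t (by omega) _ (hWm t) ⟨_, hWb t⟩]
          ring
      _ ≤ Real.exp (2 * l ^ 2 * t) * Real.exp ((2 * l) ^ 2 / 2) :=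
          mul_le_mul ih (Real.cosh_le_exp_half_sq _) (Real.cosh_pos _).le (Real.exp_pos _).le
      _ = _ := by
          rw [← Real.exp_add]; push_cast; ring_nf

lemma azuma_tail {Ω : Type} {m0 : MeasurableSpace Ω} (μ : Measure Ω) [IsProbabilityMeasure μ]
    (T : ℕ) (hT : 1 ≤ T) (G : ℕ → MeasurableSpace Ω) (hG : ∀ t, G t ≤ m0) (ξ : ℕ → Ω → ℝ)
    (hm : ∀ t, Measurable (ξ t))
    (hS : ∀ t, Measurable[G t] fun ω => ∑ s ∈ range t, ξ s ω)
    (hb : ∀ t ω, |ξ t ω| ≤ 2)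
    (h0 : ∀ t < T, ∀ W : Ω → ℝ, Measurable[G t] W → (∃ K, ∀ ω, |W ω| ≤ K) →
      ∫ ω, W ω * ξ t ω ∂μ = 0) (δ : ℝ) (hδ : δ ∈ Set.Ioo (0 : ℝ) 1) :
    ENNReal.ofReal (1 - δ) ≤
      μ {ω | ∑ s ∈ range T, ξ s ω ≤ 3 * Real.sqrt (T * Real.log (1 / δ))} := by
  have hT' : (0 : ℝ) < T := by exact_mod_cast hT
  set L := Real.log (1 / δ) with hL
  have hL0 : 0 < L := Real.log_pos (by rw [lt_div_iff₀ hδ.1]; linarith [hδ.2])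
  set e := 3 * Real.sqrt (T * L) with he
  have he2 : e ^ 2 = 9 * (T * L) := by
    rw [he, mul_pow, Real.sq_sqrt (by positivity)]; norm_num
  obtain ⟨hi, hint⟩ := azuma μ T G hG ξ hm hS hb h0 (e / (4 * T)) T le_rfl
  have hch := measure_ge_le_exp_mul_mgf (μ := μ) (X := fun ω => ∑ s ∈ range T, ξ s ω)
    (t := e / (4 * T)) e (by positivity) hi
  have hle : μ.real {ω | e ≤ ∑ s ∈ range T, ξ s ω} ≤ δ := by
    refine hch.trans ?_
    unfold mgf
    refine (mul_le_mul_of_nonneg_left hint (Real.exp_pos _).le).trans ?_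
    rw [← Real.exp_add]
    have : -(e / (4 * T)) * e + 2 * (e / (4 * T)) ^ 2 * T = - (9 / 8 * L) := by
      field_simp
      rw [he2]; ring
    rw [this]
    calc Real.exp (-(9 / 8 * L)) ≤ Real.exp (-L) := Real.exp_le_exp.2 (by linarith)
      _ = δ := by rw [hL, one_div, Real.log_inv, neg_neg, Real.exp_log hδ.1]
  have hmeas : MeasurableSet {ω | e ≤ ∑ s ∈ range T, ξ s ω} :=
    measurableSet_le measurable_const (Finset.measurable_fun_sum _ fun i _ => hm i)
  have hc := probReal_compl_eq_one_sub (μ := μ) hmeas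
  calc ENNReal.ofReal (1 - δ) ≤ ENNReal.ofReal (μ.real {ω | e ≤ ∑ s ∈ range T, ξ s ω}ᶜ) :=
        ENNReal.ofReal_le_ofReal (by linarith)
    _ = μ {ω | e ≤ ∑ s ∈ range T, ξ s ω}ᶜ := by simp
    _ ≤ _ := measure_mono fun ω hω => by
        simp only [Set.mem_compl_iff, Set.mem_ofPred_eq, not_le] at hω ⊢
        exact hω.le

lemma inner_mem {d : ℕ} (a b : EuclideanSpace ℝ (Fin d)) (ha : ‖a‖ ≤ 1) (hb : ‖b‖ ≤ 1) :
    ⟪a, b⟫ ∈ Set.Icc (-1 : ℝ) 1 := by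
  have h := abs_real_inner_le_norm a b
  have : ‖a‖ * ‖b‖ ≤ 1 := by nlinarith [norm_nonneg a, norm_nonneg b]
  exact abs_le.1 (h.trans this)

/-- Deterministic online-gradient-descent bound. -/
lemma det_bound {d T : ℕ} (hT : 1 ≤ T) (w : EuclideanSpace ℝ (Fin d)) (hw : ‖w‖ ≤ 1)
    (x θ : ℕ → EuclideanSpace ℝ (Fin d)) (r : ℕ → ℝ) (hx : ∀ t, ‖x t‖ ≤ 1)
    (hr : ∀ t, |r t| ≤ 1) (η : ℝ) (hη : η = 1 / Real.sqrt T) (h0 : θ 0 = 0)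
    (hs : ∀ t, θ (t + 1) = projBall (θ t - (η * (2 * r t)) • x t)) :
    ∑ t ∈ range T, r t * ⟪θ t - w, x t⟫ ≤ 3 * Real.sqrt T := by
  have key : ∀ n : ℕ, 4 * η * ∑ t ∈ range n, r t * ⟪θ t - w, x t⟫ ≤
      1 + 4 * η ^ 2 * n - ‖θ n - w‖ ^ 2 := by
    intro n
    induction n with
    | zero =>
      simp [h0]
      nlinarith [norm_nonneg w]
    | succ n ih =>
      have h1 := projBall_contract (θ n - (η * (2 * r n)) • x n) w hw
      rw [← hs n, sub_right_comm, norm_sub_sq_real (θ n - w), norm_smul, real_inner_smul_right,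
        mul_pow, Real.norm_eq_abs, sq_abs] at h1
      rw [sum_range_succ]
      have h2 : r n ^ 2 ≤ 1 := by rw [← sq_abs]; nlinarith [hr n, abs_nonneg (r n)]
      have h3 : ‖x n‖ ^ 2 ≤ 1 := by nlinarith [hx n, norm_nonneg (x n)]
      have h4 : r n ^ 2 * ‖x n‖ ^ 2 ≤ 1 := by nlinarith [sq_nonneg (r n), sq_nonneg ‖x n‖]
      have h5 := mul_le_mul_of_nonneg_left h4 (sq_nonneg η)
      push_cast
      nlinarith
  have hT' : (0 : ℝ) < T := by exact_mod_cast hT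
  have hq : 0 < Real.sqrt T := Real.sqrt_pos.2 hT'
  have hk := key T
  have hηT : η ^ 2 * T = 1 := by
    rw [hη, div_pow, Real.sq_sqrt hT'.le]; field_simp
  have h6 : 4 * η * ∑ t ∈ range T, r t * ⟪θ t - w, x t⟫ ≤ 5 := by
    nlinarith [sq_nonneg ‖θ T - w‖]
  rw [hη] at h6
  have h7 := mul_le_mul_of_nonneg_right h6 hq.le
  have h8 : 4 * (1 / Real.sqrt T) * (∑ t ∈ range T, r t * ⟪θ t - w, x t⟫) * Real.sqrt T =
      4 * ∑ t ∈ range T, r t * ⟪θ t - w, x t⟫ := by field_simp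
  linarith

lemma glmFilt_le {Ω : Type} {m0 : MeasurableSpace Ω} {d : ℕ}
    (x : ℕ → Ω → EuclideanSpace ℝ (Fin d)) (y : ℕ → Ω → ℝ) (hx : ∀ t, Measurable (x t))
    (hy : ∀ t, Measurable (y t)) (t : ℕ) : glmFilt x y t ≤ m0 :=
  sup_le (iSup₂_le fun s _ => sup_le (hx s).comap_le (hy s).comap_le) (hx t).comap_le

lemma glmFilt_x {Ω : Type} {d : ℕ}
    (x : ℕ → Ω → EuclideanSpace ℝ (Fin d)) (y : ℕ → Ω → ℝ) {s t : ℕ} (h : s < t) :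
    Measurable[glmFilt x y t] (x s) :=
  Measurable.of_comap_le (le_sup_of_le_left (le_iSup₂_of_le s h le_sup_left))

lemma glmFilt_y {Ω : Type} {d : ℕ}
    (x : ℕ → Ω → EuclideanSpace ℝ (Fin d)) (y : ℕ → Ω → ℝ) {s t : ℕ} (h : s < t) :
    Measurable[glmFilt x y t] (y s) :=
  Measurable.of_comap_le (le_sup_of_le_left (le_iSup₂_of_le s h le_sup_right))

lemma ip_measurable {Ω : Type} [MeasurableSpace Ω] {d : ℕ}
    (w : EuclideanSpace ℝ (Fin d)) (θ x : Ω → EuclideanSpace ℝ (Fin d))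
    (hθ : Measurable θ) (hx : Measurable x) :
    Measurable fun ω => ⟪θ ω - w, x ω⟫ := (hθ.sub_const w).inner hx

lemma mul_measurable_aux {Ω : Type} [MeasurableSpace Ω] (f g : Ω → ℝ)
    (hf : Measurable f) (hg : Measurable g) : Measurable fun ω => f ω * g ω := hf.mul hg

lemma xi_measurable {Ω : Type} [MeasurableSpace Ω] {d : ℕ} (σl : ℝ → ℝ) (hσ : Measurable σl)
    (w : EuclideanSpace ℝ (Fin d)) (θ x : Ω → EuclideanSpace ℝ (Fin d)) (y : Ω → ℝ)
    (hθ : Measurable θ) (hx : Measurable x) (hy : Measurable y) :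
    Measurable fun ω => (y ω - σl ⟪w, x ω⟫) * ⟪θ ω - w, x ω⟫ :=
  (hy.sub (hσ.comp (measurable_const.inner hx))).mul ((hθ.sub_const w).inner hx)

lemma core {Ω : Type} {m0 : MeasurableSpace Ω} (μ : Measure Ω) [IsProbabilityMeasure μ]
    (d T : ℕ) (hT : 1 ≤ T) (σl : ℝ → ℝ) (hmono : Monotone σl) (hlip : LipschitzWith 1 σl)
    (hr : ∀ u, σl u ∈ Set.Icc (0 : ℝ) 1)
    (w : EuclideanSpace ℝ (Fin d)) (hw : ‖w‖ ≤ 1)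
    (x : ℕ → Ω → EuclideanSpace ℝ (Fin d)) (y : ℕ → Ω → ℝ)
    (hxm : ∀ t, Measurable (x t)) (hym : ∀ t, Measurable (y t))
    (hxG : ∀ t, Measurable[glmFilt x y t] (x t))
    (hx : ∀ t ω, ‖x t ω‖ ≤ 1) (hy : ∀ t ω, y t ω ∈ Set.Icc (0 : ℝ) 1)
    (hc : ∀ t, t < T → μ[y t | glmFilt x y t] =ᵐ[μ] fun ω => σl ⟪w, x t ω⟫)
    (η : ℝ) (hη : η = 1 / Real.sqrt T) (θ : ℕ → Ω → EuclideanSpace ℝ (Fin d))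
    (hθ0 : ∀ ω, θ 0 ω = 0)
    (hθ : ∀ t ω, θ (t + 1) ω =
          projBall (θ t ω - (η * (2 * (σl ⟪θ t ω, x t ω⟫ - y t ω))) • x t ω))
    (δ : ℝ) (hδ : δ ∈ Set.Ioo (0 : ℝ) 1) :
    ENNReal.ofReal (1 - δ) ≤
          μ {ω | ∑ t ∈ Finset.range T, (σl ⟪θ t ω, x t ω⟫ - σl ⟪w, x t ω⟫) ^ 2
              ≤ 3 * (Real.sqrt T + Real.sqrt (T * Real.log (1 / δ)))} := by
  have hσm : Measurable σl := hlip.continuous.measurable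
  have hG := glmFilt_le x y hxm hym
  have hθn : ∀ t ω, ‖θ t ω‖ ≤ 1 := by
    intro t ω
    cases t with
    | zero => simp [hθ0]
    | succ t => rw [hθ]; exact projBall_norm_le _
  have hθG' : ∀ t u, t ≤ u → Measurable[glmFilt x y u] (θ t) := by
    intro t
    induction t with
    | zero =>
      intro u _
      have : θ 0 = fun _ => 0 := funext hθ0
      rw [this]; exact measurable_const
    | succ t ih =>
      intro u hu
      rw [funext (hθ t)]
      exact @step_measurable Ω (glmFilt x y u) d σl hσm η _ _ _ (ih u (by omega))
        (glmFilt_x x y (by omega)) (glmFilt_y x y (by omega))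
  set ξ : ℕ → Ω → ℝ := fun t ω => (y t ω - σl ⟪w, x t ω⟫) * ⟪θ t ω - w, x t ω⟫ with hξ
  have hab : ∀ t ω, |⟪θ t ω - w, x t ω⟫| ≤ 2 := by
    intro t ω
    refine (abs_real_inner_le_norm _ _).trans ?_
    have := norm_sub_le (θ t ω) w
    nlinarith [hθn t ω, hx t ω, norm_nonneg (x t ω), norm_nonneg (θ t ω - w)]
  have hξb : ∀ t ω, |ξ t ω| ≤ 2 := by
    intro t ω
    simp only [hξ]
    rw [abs_mul]
    have h1 : |y t ω - σl ⟪w, x t ω⟫| ≤ 1 := by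
      have h1 := hy t ω
      have h2 := hr ⟪w, x t ω⟫
      exact abs_le.2 ⟨by linarith [h1.1, h2.2], by linarith [h1.2, h2.1]⟩
    nlinarith [hab t ω, abs_nonneg ⟪θ t ω - w, x t ω⟫]
  have hξm : ∀ t, Measurable (ξ t) := fun t =>
    xi_measurable σl hσm w _ _ _ ((hθG' t t le_rfl).mono (hG t) le_rfl) (hxm t) (hym t)
  have hSG : ∀ t, Measurable[glmFilt x y t] fun ω => ∑ s ∈ range t, ξ s ω := by
    intro t
    refine @Finset.measurable_fun_sum _ _ _ _ _ _ (glmFilt x y t) _ _ fun s hs => ?_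
    have hs' := mem_range.1 hs
    exact @xi_measurable Ω (glmFilt x y t) d σl hσm w _ _ _ (hθG' s t hs'.le)
      (glmFilt_x x y hs') (glmFilt_y x y hs')
  have h0 : ∀ t < T, ∀ W : Ω → ℝ, Measurable[glmFilt x y t] W → (∃ K, ∀ ω, |W ω| ≤ K) →
      ∫ ω, W ω * ξ t ω ∂μ = 0 := by
    rintro t ht W hW ⟨K, hK⟩
    have haG : Measurable[glmFilt x y t] fun ω => ⟪θ t ω - w, x t ω⟫ :=
      @ip_measurable Ω (glmFilt x y t) d w _ _ (hθG' t t le_rfl) (hxG t)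
    set V : Ω → ℝ := fun ω => W ω * ⟪θ t ω - w, x t ω⟫ with hV
    have hVG : Measurable[glmFilt x y t] V := 
      @mul_measurable_aux Ω (glmFilt x y t) _ _ hW haG
    have hVb : ∀ ω, ‖V ω‖ ≤ K * 2 := fun ω => by
      rw [Real.norm_eq_abs, hV, abs_mul]
      exact mul_le_mul (hK ω) (hab t ω) (abs_nonneg _) ((abs_nonneg _).trans (hK ω))
    have hVi : Integrable V μ := Integrable.of_bound
      (hVG.mono (hG t) le_rfl).aestronglyMeasurable _ (Filter.Eventually.of_forall hVb)
    have hyi : Integrable (y t) μ := Integrable.of_bound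
      (hym t).aestronglyMeasurable 1 (Filter.Eventually.of_forall fun ω => by
        rw [Real.norm_eq_abs, abs_of_nonneg (hy t ω).1]; exact (hy t ω).2)
    have hVy : Integrable (V * y t) μ := hyi.bdd_mul (c := K * 2)
      (hVG.mono (hG t) le_rfl).aestronglyMeasurable (Filter.Eventually.of_forall hVb)
    have hsm : Measurable fun ω => σl ⟪w, x t ω⟫ :=
      hσm.comp (measurable_const.inner (hxm t))
    have hVs : Integrable (fun ω => V ω * σl ⟪w, x t ω⟫) μ := 
      hVi.mul_bdd (c := 1) hsm.aestronglyMeasurable (Filter.Eventually.of_forall fun ω => by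
        rw [Real.norm_eq_abs, abs_of_nonneg (hr _).1]; exact (hr _).2)
    have hce := condExp_mul_of_stronglyMeasurable_left (m := glmFilt x y t)
      hVG.stronglyMeasurable hVy hyi
    have e1 : ∫ ω, (V * y t) ω ∂μ = ∫ ω, V ω * σl ⟪w, x t ω⟫ ∂μ := by
      rw [← integral_condExp (hG t)]
      refine integral_congr_ae ?_
      filter_upwards [hce, hc t ht] with ω h1 h2
      rw [h1, Pi.mul_apply, h2]
    calc ∫ ω, W ω * ξ t ω ∂μ = ∫ ω, ((V * y t) ω - V ω * σl ⟪w, x t ω⟫) ∂μ := by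
          congr 1; ext ω; simp only [hV, hξ, Pi.mul_apply]; ring
      _ = 0 := by rw [integral_sub hVy hVs, e1, sub_self]
  refine (azuma_tail μ T hT (glmFilt x y) hG ξ hξm hSG hξb h0 δ hδ).trans
    (measure_mono fun ω hω => ?_)
  simp only [Set.mem_ofPred_eq] at hω ⊢
  have hdet := det_bound hT w hw (fun t => x t ω) (fun t => θ t ω)
    (fun t => σl ⟪θ t ω, x t ω⟫ - y t ω) (fun t => hx t ω) (fun t => by
      have h1 := hy t ω
      have h2 := hr ⟪θ t ω, x t ω⟫
      exact abs_le.2 ⟨by linarith [h1.2, h2.1], by linarith [h1.1, h2.2]⟩) η hη (hθ0 ω)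
    (fun t => hθ t ω)
  have hpt : ∀ t ∈ range T, (σl ⟪θ t ω, x t ω⟫ - σl ⟪w, x t ω⟫) ^ 2 ≤
      (σl ⟪θ t ω, x t ω⟫ - y t ω) * ⟪θ t ω - w, x t ω⟫ + ξ t ω := by
    intro t _
    simp only [hξ]
    rw [inner_sub_left]
    generalize ⟪θ t ω, x t ω⟫ = a
    generalize ⟪w, x t ω⟫ = b
    have hl := hlip.dist_le_mul a b
    simp only [NNReal.coe_one, one_mul, Real.dist_eq] at hl
    have : (σl a - σl b) ^ 2 ≤ (σl a - σl b) * (a - b) := by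
      rcases le_total a b with h | h
      · have := hmono h
        rw [abs_of_nonpos (by linarith), abs_of_nonpos (by linarith)] at hl
        nlinarith
      · have := hmono h
        rw [abs_of_nonneg (by linarith), abs_of_nonneg (by linarith)] at hl
        nlinarith
    nlinarith
  have := sum_le_sum hpt
  rw [sum_add_distrib] at this
  linarith

/-- Proposition `glm1`, projected GLMtron: there is a universal
constant `C > 0` such that for every nondecreasing `1`-Lipschitz link function
`σ : [−1,1] → [0,1]`, every `θ*` in the unit ball, and every adaptive online
prediction process with `‖x_t‖ ≤ 1`, `y_t ∈ [0,1]`, and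
`E[y_t | G_{t-1}] = σ(⟨θ*, x_t⟩)`, projected GLMtron
(`θ_1 = 0`, `θ_{t+1} = Proj_{B_d}(θ_t − η g_t)` with
`g_t = 2(σ(⟨θ_t,x_t⟩) − y_t) x_t` and `η = 1/√T`) satisfies, for every `δ ∈ (0,1)`,
with probability at least `1 − δ`,
`Σ_{t=1}^T (σ(⟨θ_t,x_t⟩) − σ(⟨θ*,x_t⟩))² ≤ C(√T + √(T log(1/δ)))`. -/
theorem glmtron_regret :
    ∃ C : ℝ, 0 < C ∧
      ∀ (Ω : Type) (m0 : MeasurableSpace Ω) (μ : Measure Ω), IsProbabilityMeasure μ →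
      ∀ (d T : ℕ), 1 ≤ T →
      ∀ (σl : ℝ → ℝ),
        (∀ u v : ℝ, u ∈ Set.Icc (-1 : ℝ) 1 → v ∈ Set.Icc (-1 : ℝ) 1 → u ≤ v →
          σl u ≤ σl v) →
        (LipschitzOnWith 1 σl (Set.Icc (-1 : ℝ) 1)) →
        (∀ u ∈ Set.Icc (-1 : ℝ) 1, σl u ∈ Set.Icc (0 : ℝ) 1) →
      ∀ (θstar : EuclideanSpace ℝ (Fin d)), ‖θstar‖ ≤ 1 →
      ∀ (x : ℕ → Ω → EuclideanSpace ℝ (Fin d)) (y : ℕ → Ω → ℝ),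
        (∀ t, Measurable (x t)) → (∀ t, Measurable (y t)) →
        -- the features are chosen adaptively: x_t is G_{t-1}-measurable
        (∀ t, Measurable[glmFilt x y t] (x t)) →
        (∀ t ω, ‖x t ω‖ ≤ 1) → (∀ t ω, y t ω ∈ Set.Icc (0 : ℝ) 1) →
        -- realizability: E[y_t | G_{t-1}] = σ(⟨θ*, x_t⟩)
        (∀ t, t < T → μ[y t | glmFilt x y t] =ᵐ[μ] fun ω => σl ⟪θstar, x t ω⟫) →
      ∀ (η : ℝ), η = 1 / Real.sqrt T →
      ∀ (θ : ℕ → Ω → EuclideanSpace ℝ (Fin d)),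
        (∀ ω, θ 0 ω = 0) →
        -- projected GLMtron updates
        (∀ t ω, θ (t + 1) ω =
          projBall (θ t ω - (η * (2 * (σl ⟪θ t ω, x t ω⟫ - y t ω))) • x t ω)) →
      ∀ δ : ℝ, δ ∈ Set.Ioo (0 : ℝ) 1 →
        ENNReal.ofReal (1 - δ) ≤
          μ {ω | ∑ t ∈ Finset.range T, (σl ⟪θ t ω, x t ω⟫ - σl ⟪θstar, x t ω⟫) ^ 2
              ≤ C * (Real.sqrt T + Real.sqrt (T * Real.log (1 / δ)))} := by
  refine ⟨3, by norm_num, ?_⟩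
  intro Ω m0 μ hμ d T hT σl hmono hlip hr w hw x y hxm hym hxG hx hy hc η hη θ hθ0 hθ δ hδ
  have hθn : ∀ t ω, ‖θ t ω‖ ≤ 1 := by
    intro t ω
    cases t with
    | zero => simp [hθ0]
    | succ t => rw [hθ]; exact projBall_norm_le _
  have hp : ∀ u : ℝ, max (-1) (min 1 u) ∈ Set.Icc (-1 : ℝ) 1 := fun u =>
    ⟨le_max_left _ _, max_le (by norm_num) (min_le_left _ _)⟩
  have hpe : ∀ u ∈ Set.Icc (-1 : ℝ) 1, max (-1) (min 1 u) = u := fun u hu => by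
    rw [min_eq_right hu.2, max_eq_right hu.1]
  have e1 : ∀ t ω, σl ⟪θ t ω, x t ω⟫ = σl (max (-1) (min 1 ⟪θ t ω, x t ω⟫)) := fun t ω => by
    rw [hpe _ (inner_mem _ _ (hθn t ω) (hx t ω))]
  have e2 : ∀ t ω, σl ⟪w, x t ω⟫ = σl (max (-1) (min 1 ⟪w, x t ω⟫)) := fun t ω => by
    rw [hpe _ (inner_mem _ _ hw (hx t ω))]
  have hm' : Monotone fun u : ℝ => max (-1) (min 1 u) := fun u v h =>
    max_le_max le_rfl (min_le_min le_rfl h)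
  have hl' : LipschitzWith 1 fun u : ℝ => max (-1) (min 1 u) :=
    (LipschitzWith.id.const_min 1).const_max (-1)
  have := core μ d T hT (fun u => σl (max (-1) (min 1 u)))
    (fun u v h => hmono _ _ (hp u) (hp v) (hm' h))
    (LipschitzWith.of_dist_le_mul fun u v =>
      (hlip.dist_le_mul _ (hp u) _ (hp v)).trans (by
        have := hl'.dist_le_mul u v
        simpa using this))
    (fun u => hr _ (hp u)) w hw x y hxm hym hxG hx hy
    (fun t ht => by simpa only [← e2] using hc t ht) η hη θ hθ0
    (fun t ω => by simpa only [← e1] using hθ t ω) δ hδ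
  simpa only [← e1, ← e2] using this
end
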